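/- arXiv:2204.10518 — 5 statements merged into one kernel-verified Lean document; each statement's English description precedes it below -/
import Mathlib

section
/- Let F be a field and let S be a cancellative semigroup such that the semigroup algebra FS is a centrally essential ring. Then S satisfies the left and right Ore conditions (so the group of fractions G_S of S exists), and the group algebra F[G_S] is a centrally essential ring. -/
/-- A (not necessarily unital) ring `R` is centrally essential if for every element `a`
not lying in the center, there exist nonzero central elements `x, y` with `a * x = y`. -/
def IsCentrallyEssential (R : Type*) [NonUnitalNonAssocSemiring R] : Prop :=
  ∀ a : R, a ∉ Set.center R →
    ∃ x y : R, x ∈ Set.center R ∧ y ∈ Set.center R ∧ x ≠ 0 ∧ y ≠ 0 ∧ a * x = y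

universe u v

namespace MonoidAlgebra

section Ore

variable {F S : Type*} [Field F] [Semigroup S]

theorem exists_mul_eq_mul_of_single_mul_eq_single_mul [IsLeftCancelMul S] {s t : S}
    {x y : MonoidAlgebra F S} (hx : x ≠ 0) (h : single s 1 * x = single t 1 * y) :
    ∃ a b : S, s * a = t * b := by
  classical
  obtain ⟨a, ha⟩ := Finsupp.support_nonempty_iff.2 (coeff_eq_zero.not.2 hx)
  have hmem : s * a ∈ (single s (1 : F) * x).coeff.support := by
    rw [support_coeff_single_mul _ _ (by simp)]
    exact Finset.mem_map_of_mem (mulLeftEmbedding s) ha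
  rw [h] at hmem
  obtain ⟨b, -, hb⟩ := Finset.mem_image.1 (support_coeff_single_mul_subset _ _ _ hmem)
  exact ⟨a, b, hb.symm⟩

theorem exists_mul_eq_mul_of_mul_single_eq_mul_single [IsRightCancelMul S] {s t : S}
    {x y : MonoidAlgebra F S} (hx : x ≠ 0) (h : x * single s 1 = y * single t 1) :
    ∃ a b : S, a * s = b * t := by
  classical
  obtain ⟨a, ha⟩ := Finsupp.support_nonempty_iff.2 (coeff_eq_zero.not.2 hx)
  have hmem : a * s ∈ (x * single s (1 : F)).coeff.support := by
    rw [support_coeff_mul_single _ _ (by simp)]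
    exact Finset.mem_map_of_mem (mulRightEmbedding s) ha
  rw [h] at hmem
  obtain ⟨b, -, hb⟩ := Finset.mem_image.1 (support_coeff_mul_single_subset _ _ _ hmem)
  exact ⟨a, b, hb.symm⟩

theorem mul_comm_of_single_mem_center {s : S}
    (hs : single s (1 : F) ∈ Set.center (MonoidAlgebra F S)) (t : S) : t * s = s * t := by
  have := Semigroup.mem_center_iff.1 hs (single t 1)
  rw [single_mul_single, single_mul_single] at this
  exact (single_left_inj (by simp)).1 this

end Ore

section Group

variable {F G : Type*} [Field F] [Group G]

/-- The elements of `G` fixing `x` under left multiplication. -/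
def leftStabilizer (x : MonoidAlgebra F G) : Subgroup G where
  carrier := {g | single g 1 * x = x}
  one_mem' := by simp [← one_def]
  mul_mem' {a b} ha hb := by
    simp only [Set.mem_ofPred_eq] at *
    rw [← one_mul (1 : F), ← single_mul_single, mul_assoc, hb, ha]
  inv_mem' {a} ha := by
    simp only [Set.mem_ofPred_eq] at *
    conv_lhs => rw [← ha, ← mul_assoc, single_mul_single]
    simp [← one_def]

theorem mem_leftStabilizer {x : MonoidAlgebra F G} {g : G} :
    g ∈ leftStabilizer x ↔ single g 1 * x = x := Iff.rfl

theorem finite_leftStabilizer {x : MonoidAlgebra F G} (hx : x ≠ 0) :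
    Finite (leftStabilizer x) := by
  obtain ⟨a, ha⟩ := Finsupp.support_nonempty_iff.2 (coeff_eq_zero.not.2 hx)
  have hmem (g : leftStabilizer x) : (g : G)⁻¹ * a ∈ x.coeff.support := by
    have h := congrArg (fun z => z.coeff a) (mem_leftStabilizer.1 g.2)
    simp only [coeff_single_mul_apply, one_mul] at h
    rw [Finsupp.mem_support_iff] at ha ⊢
    rwa [h]
  refine Finite.of_injective (fun g => (⟨_, hmem g⟩ : x.coeff.support)) fun g h hgh => ?_
  simpa using hgh

theorem normal_leftStabilizer {x : MonoidAlgebra F G}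
    (hx : x ∈ Set.center (MonoidAlgebra F G)) : (leftStabilizer x).Normal where
  conj_mem n hn g := by
    rw [mem_leftStabilizer] at *
    rw [← one_mul (1 : F), ← single_mul_single, mul_assoc, Semigroup.mem_center_iff.1 hx,
      ← mul_one (1 : F), ← single_mul_single, mul_assoc, ← mul_assoc _ x, mul_one, hn,
      ← Semigroup.mem_center_iff.1 hx, ← mul_assoc, single_mul_single]
    simp [← one_def]

theorem commutator_mem_leftStabilizer {x : MonoidAlgebra F G} {t : G}
    (hx : x ∈ Set.center (MonoidAlgebra F G))
    (hy : single t 1 * x ∈ Set.center (MonoidAlgebra F G)) (g : G) :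
    t⁻¹ * (g * t * g⁻¹) ∈ leftStabilizer x := by
  have h1 : single (g * t * g⁻¹) 1 * x = single t 1 * x := by
    rw [← one_mul (1 : F), ← single_mul_single, mul_assoc, Semigroup.mem_center_iff.1 hx,
      ← one_mul (1 : F), ← single_mul_single, ← mul_assoc, mul_assoc _ _ x, one_mul, mul_assoc,
      mul_assoc, ← mul_assoc (single t 1),
      ← Semigroup.mem_center_iff.1 hy, ← mul_assoc, single_mul_single]
    simp [← one_def]
  rw [mem_leftStabilizer, ← one_mul (1 : F), ← single_mul_single, mul_assoc, h1, ← mul_assoc,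
    single_mul_single]
  simp [← one_def]

end Group

end MonoidAlgebra

/-- If all the commutators of `t` lie in a finite normal subgroup, a power of `t` is central. -/
theorem Subgroup.exists_pow_mem_center {G : Type*} [Group G] (H : Subgroup G) [H.Normal]
    [Finite H] {t : G} (ht : ∀ g : G, t⁻¹ * (g * t * g⁻¹) ∈ H) :
    ∃ n : ℕ, t ^ (n + 1) ∈ Subgroup.center G := by
  set m := Nat.card (MulAut H)
  set k := Nat.card H
  have hm : 0 < m := Nat.card_pos
  have hk : 0 < k := Nat.card_pos
  have hcomm (h : H) : Commute (t ^ m) (h : G) := by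
    have h1 : MulAut.conjNormal (H := H) (t ^ m) = 1 := by rw [map_pow, pow_card_eq_one']
    have h2 := MulAut.conjNormal_apply (t ^ m) h
    rw [h1, MulAut.one_apply] at h2
    exact (eq_mul_inv_iff_mul_eq.1 h2).symm
  have hcoset (g : G) : (t ^ m)⁻¹ * (g * t ^ m * g⁻¹) ∈ H := by
    rw [← QuotientGroup.eq]
    have h1 : ((t : G) : G ⧸ H) = ((g * t * g⁻¹ : G) : G ⧸ H) := QuotientGroup.eq.2 (ht g)
    rw [← conj_pow, QuotientGroup.mk_pow, QuotientGroup.mk_pow, h1]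
  refine ⟨m * k - 1, ?_⟩
  rw [Nat.sub_add_cancel (Nat.mul_pos hm hk), Subgroup.mem_center_iff]
  intro g
  have h1 : g * t ^ m * g⁻¹ = t ^ m * ((t ^ m)⁻¹ * (g * t ^ m * g⁻¹)) := by group
  have h2 : g * t ^ (m * k) * g⁻¹ = t ^ (m * k) := by
    rw [pow_mul, ← conj_pow, h1, (hcomm ⟨_, hcoset g⟩).mul_pow]
    have h3 : (⟨_, hcoset g⟩ : H) ^ k = 1 := pow_card_eq_one'
    have h4 := congrArg Subtype.val h3
    simp only [SubmonoidClass.mk_pow, OneMemClass.coe_one] at h4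
    rw [h4, mul_one]
  exact mul_inv_eq_iff_eq_mul.1 h2

namespace MonoidAlgebra

section Fractions

variable {F S G : Type*} [Field F] [Semigroup S] [Group G] {φ : S →ₙ* G}

theorem mem_center_of_commute_single {x : MonoidAlgebra F G}
    (hx : ∀ g : G, single g 1 * x = x * single g 1) : x ∈ Set.center (MonoidAlgebra F G) := by
  rw [Semigroup.mem_center_iff]
  intro y
  induction y using induction_linear with
  | zero => simp
  | add a b ha hb => rw [add_mul, mul_add, ha, hb]
  | single g r =>
    rw [← mul_one r, ← smul_single', smul_mul_assoc, mul_smul_comm, hx]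

theorem mapDomain_mem_center (hφ : ∀ g : G, ∃ s t : S, g = φ s * (φ t)⁻¹)
    {x : MonoidAlgebra F S} (hx : x ∈ Set.center (MonoidAlgebra F S)) :
    mapDomain φ x ∈ Set.center (MonoidAlgebra F G) := by
  have hS (s : S) : Commute (of F G (φ s)) (mapDomain φ x) := by
    have h := congrArg (mapDomain φ) (Semigroup.mem_center_iff.1 hx (single s 1))
    rw [mapDomain_mul, mapDomain_mul, mapDomain_single] at h
    exact h
  refine mem_center_of_commute_single fun g => ?_
  obtain ⟨s, t, rfl⟩ := hφ g
  have hinv : Commute (of F G (φ t)⁻¹) (mapDomain φ x) := by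
    let u : (MonoidAlgebra F G)ˣ := Units.map (of F G) (toUnits (φ t))
    exact Commute.units_inv_left (u := u) (hS t)
  have h := (hS s).mul_left hinv
  rw [← map_mul] at h
  exact h

theorem exists_mul_single_mem_range (hore : ∀ s t : S, ∃ a b : S, s * a = t * b)
    (hφ : ∀ g : G, ∃ s t : S, g = φ s * (φ t)⁻¹) (a : MonoidAlgebra F G) :
    ∃ (t : S) (b : MonoidAlgebra F S), a * single (φ t) 1 = mapDomain φ b := by
  induction a using induction_linear with
  | zero =>
    obtain ⟨s, -⟩ := hφ 1
    exact ⟨s, 0, by simp⟩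
  | single g r =>
    obtain ⟨s, t, rfl⟩ := hφ g
    exact ⟨t, single s r, by simp [single_mul_single]⟩
  | add a₁ a₂ h₁ h₂ =>
    obtain ⟨t₁, b₁, h₁⟩ := h₁
    obtain ⟨t₂, b₂, h₂⟩ := h₂
    obtain ⟨u, v, huv⟩ := hore t₁ t₂
    refine ⟨t₁ * u, b₁ * single u 1 + b₂ * single v 1, ?_⟩
    rw [mapDomain_add, mapDomain_mul, mapDomain_mul, ← h₁, ← h₂, mapDomain_single,
      mapDomain_single, mul_assoc, mul_assoc, single_mul_single, single_mul_single, ← map_mul,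
      ← map_mul, ← huv, add_mul, one_mul]

theorem mul_single_pow_mem_range {a : MonoidAlgebra F G} {t : S} {b : MonoidAlgebra F S}
    (h : a * single (φ t) 1 = mapDomain φ b) (n : ℕ) :
    ∃ c : MonoidAlgebra F S, a * single (φ t ^ (n + 1)) 1 = mapDomain φ c := by
  induction n with
  | zero => exact ⟨b, by simpa using h⟩
  | succ n ih =>
    obtain ⟨c, hc⟩ := ih
    refine ⟨c * single t 1, ?_⟩
    rw [mapDomain_mul, ← hc, mapDomain_single, mul_assoc, single_mul_single, ← pow_succ, one_mul]

end Fractions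

end MonoidAlgebra

namespace IsCentrallyEssential

open MonoidAlgebra

variable {F S : Type*} [Field F] [Semigroup S]

theorem right_ore [IsLeftCancelMul S] (h : IsCentrallyEssential (MonoidAlgebra F S)) (s t : S) :
    ∃ a b : S, s * a = t * b := by
  by_cases hs : single s (1 : F) ∈ Set.center (MonoidAlgebra F S)
  · exact ⟨t, s, (mul_comm_of_single_mem_center hs t).symm⟩
  obtain ⟨x, y, -, hy, -, hy0, hxy⟩ := h _ hs
  obtain ⟨a, b, hab⟩ := exists_mul_eq_mul_of_single_mul_eq_single_mul (s := t) (t := s)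
    (y := x * single t 1) hy0 (by rw [Semigroup.mem_center_iff.1 hy, ← hxy, mul_assoc])
  exact ⟨b, a, hab.symm⟩

theorem left_ore [IsRightCancelMul S] (h : IsCentrallyEssential (MonoidAlgebra F S)) (s t : S) :
    ∃ a b : S, a * s = b * t := by
  by_cases hs : single s (1 : F) ∈ Set.center (MonoidAlgebra F S)
  · exact ⟨t, s, mul_comm_of_single_mem_center hs t⟩
  obtain ⟨x, y, hx, hy, -, hy0, hxy⟩ := h _ hs
  obtain ⟨a, b, hab⟩ := exists_mul_eq_mul_of_mul_single_eq_mul_single (s := t) (t := s)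
    (y := single t 1 * x) hy0
    (by rw [← Semigroup.mem_center_iff.1 hy, ← hxy, Semigroup.mem_center_iff.1 hx, mul_assoc])
  exact ⟨b, a, hab.symm⟩

variable {G : Type*} [Group G] {φ : S →ₙ* G}

theorem exists_pow_mem_center (h : IsCentrallyEssential (MonoidAlgebra F S))
    (hinj : Function.Injective φ) (hφ : ∀ g : G, ∃ s t : S, g = φ s * (φ t)⁻¹) (t : S) :
    ∃ n : ℕ, φ t ^ (n + 1) ∈ Subgroup.center G := by
  by_cases ht : single t (1 : F) ∈ Set.center (MonoidAlgebra F S)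
  · refine ⟨0, Subgroup.mem_center_iff.2 fun g => ?_⟩
    have := mapDomain_mem_center hφ ht
    rw [mapDomain_single] at this
    simpa using mul_comm_of_single_mem_center this g
  obtain ⟨x, y, hx, hy, hx0, -, hxy⟩ := h _ ht
  have hx' := mapDomain_mem_center hφ hx
  have hy' := mapDomain_mem_center hφ hy
  rw [← hxy, mapDomain_mul, mapDomain_single] at hy'
  have hx0' : mapDomain φ x ≠ 0 := fun h0 =>
    hx0 (mapDomain_injective hinj (h0.trans (mapDomain_zero _).symm))
  have := finite_leftStabilizer hx0'
  have := normal_leftStabilizer hx'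
  exact (leftStabilizer (mapDomain φ x)).exists_pow_mem_center
    (commutator_mem_leftStabilizer hx' hy')

theorem of_fractions [IsLeftCancelMul S] (h : IsCentrallyEssential (MonoidAlgebra F S))
    (hinj : Function.Injective φ) (hφ : ∀ g : G, ∃ s t : S, g = φ s * (φ t)⁻¹) :
    IsCentrallyEssential (MonoidAlgebra F G) := by
  intro a ha
  have hne {x : MonoidAlgebra F S} (hx : x ≠ 0) : mapDomain φ x ≠ 0 := fun h0 =>
    hx (mapDomain_injective hinj (h0.trans (mapDomain_zero _).symm))
  obtain ⟨t, b, hb⟩ := exists_mul_single_mem_range h.right_ore hφ a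
  obtain ⟨n, hn⟩ := h.exists_pow_mem_center hinj hφ t
  obtain ⟨c, hc⟩ := mul_single_pow_mem_range hb n
  set z : MonoidAlgebra F G := single (φ t ^ (n + 1)) 1
  have hz : z ∈ Set.center (MonoidAlgebra F G) := mem_center_of_commute_single fun g => by
    rw [single_mul_single, single_mul_single, Subgroup.mem_center_iff.1 hn]
  have hz0 : z ≠ 0 := by simp [z]
  by_cases hcc : c ∈ Set.center (MonoidAlgebra F S)
  · refine ⟨z, mapDomain φ c, hz, mapDomain_mem_center hφ hcc, hz0, ?_, hc⟩
    rw [← hc]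
    intro h0
    have h1 : a = a * z * single (φ t ^ (n + 1))⁻¹ 1 := by
      rw [mul_assoc, single_mul_single]
      simp [← one_def]
    rw [h0, zero_mul] at h1
    exact ha (h1 ▸ Set.zero_mem_center)
  obtain ⟨x, y, hx, hy, -, hy0, hxy⟩ := h _ hcc
  have hmul : a * (z * mapDomain φ x) = mapDomain φ y := by
    rw [← mul_assoc, hc, ← mapDomain_mul, hxy]
  refine ⟨z * mapDomain φ x, mapDomain φ y, Set.mul_mem_center hz (mapDomain_mem_center hφ hx),
    mapDomain_mem_center hφ hy, fun h0 => hne hy0 ?_, hne hy0, hmul⟩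
  rw [← hmul, h0, mul_zero]

end IsCentrallyEssential

/-- If `S` is a cancellative semigroup and the semigroup algebra `F[S]` is centrally
essential, then `S` satisfies the right and left Ore conditions (so the group of fractions
of `S` exists), and for any group of fractions `G` of `S` the group algebra `F[G]` is
centrally essential. -/
theorem stmt0 (F : Type v) [Field F] (S : Type u) [Semigroup S] [IsCancelMul S]
    (h : IsCentrallyEssential (MonoidAlgebra F S)) :
    ((∀ s t : S, ∃ a b : S, s * a = t * b) ∧ (∀ s t : S, ∃ a b : S, a * s = b * t)) ∧
    ∀ (G : Type u) [Group G] (φ : S →ₙ* G),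
      Function.Injective φ →
      (∀ g : G, ∃ s t : S, g = φ s * (φ t)⁻¹) →
      (∀ g : G, ∃ s t : S, g = (φ s)⁻¹ * φ t) →
      IsCentrallyEssential (MonoidAlgebra F G) := by
  exact ⟨⟨h.right_ore, h.left_ore⟩, fun _ _ _ hinj hφ _ => h.of_fractions hinj hφ⟩
end

section
/- Let F be a field and let S be a cancellative semigroup that has a group of fractions G_S. If the group algebra F[G_S] is a centrally essential ring, then the semigroup algebra FS is a centrally essential ring. -/
universe u v w

/-- The coefficients of a central element of a group algebra are constant on conjugacy classes. -/
theorem MonoidAlgebra.coeff_conj_of_mem_center {F G : Type*} [Semiring F] [Group G]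
    {x : MonoidAlgebra F G} (hx : x ∈ Set.center (MonoidAlgebra F G)) (u g : G) :
    x.coeff (u * g * u⁻¹) = x.coeff g := by
  have h := congrArg (fun z => z.coeff (u * g))
    (Semigroup.mem_center_iff.1 hx (MonoidAlgebra.single u 1))
  simpa using h.symm

/-- A group element in the support of a central element of a group algebra has finitely many
conjugates. -/
theorem MonoidAlgebra.finite_range_conj_of_mem_center {F G : Type*} [Semiring F] [Group G]
    {x : MonoidAlgebra F G} (hx : x ∈ Set.center (MonoidAlgebra F G)) {g : G}
    (hg : x.coeff g ≠ 0) : (Set.range fun u : G => u * g * u⁻¹).Finite := by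
  refine x.coeff.support.finite_toSet.subset ?_
  rintro _ ⟨u, rfl⟩
  simpa [MonoidAlgebra.coeff_conj_of_mem_center hx] using hg

/-- A group with a centrally essential group algebra has finite conjugacy classes. -/
theorem IsCentrallyEssential.finite_range_conj {F G : Type*} [Semiring F] [Nontrivial F] [Group G]
    (h : IsCentrallyEssential (MonoidAlgebra F G)) (g : G) :
    (Set.range fun u : G => u * g * u⁻¹).Finite := by
  by_cases hg : MonoidAlgebra.single g (1 : F) ∈ Set.center (MonoidAlgebra F G)
  · exact MonoidAlgebra.finite_range_conj_of_mem_center hg (by simp)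
  obtain ⟨x, y, hx, hy, hx0, -, hxy⟩ := h _ hg
  obtain ⟨k, hk⟩ : ∃ k, x.coeff k ≠ 0 := by
    by_contra! hk
    exact hx0 (MonoidAlgebra.coeff_injective (Finsupp.ext hk))
  have hgk : y.coeff (g * k) ≠ 0 := by simpa [← hxy] using hk
  refine ((MonoidAlgebra.finite_range_conj_of_mem_center hy hgk).image2 (fun a b => a * b⁻¹)
    (MonoidAlgebra.finite_range_conj_of_mem_center hx hk)).subset ?_
  rintro _ ⟨u, rfl⟩
  exact ⟨_, ⟨u, rfl⟩, _, ⟨u, rfl⟩, by group⟩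

/-- If `t` has finitely many conjugates, then every `g` has a positive power commuting with `t`. -/
theorem exists_commute_pow_of_finite_range_conj {G : Type*} [Group G] {t : G}
    (ht : (Set.range fun u : G => u * t * u⁻¹).Finite) (g : G) :
    ∃ n : ℕ, 0 < n ∧ Commute (g ^ n) t := by
  have : Finite (Set.range fun u : G => u * t * u⁻¹) := ht
  obtain ⟨a, b, hab, he⟩ := Finite.exists_ne_map_eq_of_infinite
    (fun n : ℕ => (⟨g ^ n * t * (g ^ n)⁻¹, g ^ n, rfl⟩ : Set.range fun u : G => u * t * u⁻¹))
  wlog hlt : a < b generalizing a b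
  · exact this b a hab.symm he.symm (by omega)
  obtain ⟨d, rfl⟩ := Nat.exists_eq_add_of_lt hlt
  refine ⟨d + 1, by omega, ?_⟩
  have he' : g ^ a * t * (g ^ a)⁻¹ = g ^ (a + d + 1) * t * (g ^ (a + d + 1))⁻¹ :=
    congrArg Subtype.val he
  rw [add_assoc, pow_add] at he'
  have : t = g ^ (d + 1) * t * (g ^ (d + 1))⁻¹ := by
    have h2 := congrArg (fun z => (g ^ a)⁻¹ * z * g ^ a) he'
    simpa [mul_assoc] using h2
  exact (mul_inv_eq_iff_eq_mul.1 this.symm)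

/-- In a group with finite conjugacy classes, every element has a positive central power. -/
theorem exists_pow_mem_center_of_finite_range_conj {G : Type*} [Group G]
    (hG : ∀ g : G, (Set.range fun u : G => u * g * u⁻¹).Finite) (g : G) :
    ∃ n : ℕ, 0 < n ∧ g ^ n ∈ Set.center G := by
  choose n hn hcomm using fun t : G => exists_commute_pow_of_finite_range_conj (hG t) g
  choose! t ht using fun c (hc : c ∈ Set.range fun u : G => u * g * u⁻¹) => hc
  set N := ∏ c ∈ (hG g).toFinset, n (t c) with hN
  refine ⟨N, Finset.prod_pos fun c _ => hn _, Semigroup.mem_center_iff.2 fun u => ?_⟩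
  have hc : u * g * u⁻¹ ∈ Set.range fun u : G => u * g * u⁻¹ := ⟨u, rfl⟩
  obtain ⟨d, hd⟩ : n (t (u * g * u⁻¹)) ∣ N :=
    Finset.dvd_prod_of_mem (fun c => n (t c)) ((hG g).mem_toFinset.2 hc)
  have hN' : Commute (g ^ N) (t (u * g * u⁻¹)) := by
    rw [hd, pow_mul]
    exact (hcomm _).pow_left d
  have h1 : u * g ^ N * u⁻¹ = g ^ N := by
    rw [← conj_pow, ← ht _ hc, conj_pow, ← hN'.eq, mul_inv_cancel_right]
  exact mul_inv_eq_iff_eq_mul.1 h1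

/-- The image of a semigroup under a multiplicative map is closed under positive powers. -/
theorem MulHom.pow_succ_mem_range {S G : Type*} [Mul S] [Monoid G] (φ : S →ₙ* G) (s : S) (n : ℕ) :
    φ s ^ (n + 1) ∈ Set.range φ := by
  induction n with
  | zero => exact ⟨s, by simp⟩
  | succ n ih =>
    obtain ⟨r, hr⟩ := ih
    exact ⟨r * s, by rw [map_mul, hr, ← pow_succ]⟩

/-- If a group of right fractions has finite conjugacy classes, then finitely many fractions have a
common central denominator. -/
theorem exists_central_common_denominator {S G : Type*} [Mul S] [Group G] (φ : S →ₙ* G)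
    (hfrac : ∀ g : G, ∃ s t : S, g = φ s * (φ t)⁻¹)
    (hG : ∀ g : G, (Set.range fun u : G => u * g * u⁻¹).Finite) (T : Finset G) :
    ∃ z : S, φ z ∈ Set.center G ∧ ∀ g ∈ T, g * φ z ∈ Set.range φ := by
  classical
  induction T using Finset.induction_on with
  | empty =>
    obtain ⟨s, -, -⟩ := hfrac 1
    obtain ⟨n, hn, hc⟩ := exists_pow_mem_center_of_finite_range_conj hG (φ s)
    obtain ⟨k, rfl⟩ := Nat.exists_eq_succ_of_ne_zero hn.ne'
    obtain ⟨z, hz⟩ := φ.pow_succ_mem_range s k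
    exact ⟨z, by rwa [hz], by simp⟩
  | insert g T _ ih =>
    obtain ⟨z, hzc, hz⟩ := ih
    obtain ⟨s, t, rfl⟩ := hfrac g
    obtain ⟨n, hn, hc⟩ := exists_pow_mem_center_of_finite_range_conj hG (φ t)
    obtain ⟨k, rfl⟩ := Nat.exists_eq_succ_of_ne_zero hn.ne'
    obtain ⟨w, hw⟩ := φ.pow_succ_mem_range t k
    obtain ⟨v, hv⟩ := φ.pow_succ_mem_range t (2 * k)
    have hwc : φ w ∈ Set.center G := by rwa [hw]
    refine ⟨z * (w * w), by
      simpa only [map_mul] using Set.mul_mem_center hzc (Set.mul_mem_center hwc hwc), ?_⟩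
    intro g hg
    rcases Finset.mem_insert.1 hg with rfl | hg
    · refine ⟨s * (v * z), ?_⟩
      have hvw : φ w * φ w = φ t * φ v := by
        rw [hv, hw, ← pow_add, ← pow_succ']
        congr 1
        omega
      have hzc' := Semigroup.mem_center_iff.1 hzc (φ w * φ w)
      simp only [map_mul]
      rw [← hzc', hvw]
      group
    · obtain ⟨r, hr⟩ := hz g hg
      exact ⟨r * (w * w), by simp only [map_mul, hr, mul_assoc]⟩

/-- An element mapped into the center by an injective multiplicative map is central. -/
theorem mem_center_of_map_mem_center {A B : Type*} [Semigroup A] [Semigroup B] (f : A →ₙ* B)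
    (hf : Function.Injective f) {a : A} (ha : f a ∈ Set.center B) : a ∈ Set.center A :=
  Semigroup.mem_center_iff.2 fun b => hf <| by
    simpa only [map_mul] using Semigroup.mem_center_iff.1 ha (f b)

/-- A central group element gives a central element of the group algebra. -/
theorem MonoidAlgebra.single_one_mem_center {F G : Type*} [Semiring F] [Semigroup G] {g : G}
    (hg : g ∈ Set.center G) : MonoidAlgebra.single g (1 : F) ∈ Set.center (MonoidAlgebra F G) :=
  Semigroup.mem_center_iff.2 fun x => (MonoidAlgebra.single_commute
    (fun m => (Semigroup.mem_center_iff.1 hg m).symm) (fun r => Commute.one_left r) x).symm.eq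

/-- An element of the group algebra becomes an element of the semigroup algebra after
multiplication by a common denominator of its support. -/
theorem MonoidAlgebra.exists_mapDomain_eq_mul_single {F S G : Type*} [Semiring F] [Group G]
    {φ : S → G} (hinj : Function.Injective φ) {x : MonoidAlgebra F G} {z : G}
    (hz : ∀ g ∈ x.coeff.support, g * z ∈ Set.range φ) :
    ∃ x' : MonoidAlgebra F S, MonoidAlgebra.mapDomain φ x' = x * MonoidAlgebra.single z 1 := by
  refine ⟨_, MonoidAlgebra.mapDomain_comapDomain (fun g hg => ?_) hinj⟩
  have hg' : x.coeff (g * z⁻¹) ≠ 0 := by simpa using hg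
  simpa using hz _ (Finsupp.mem_support_iff.2 hg')

/-- If `S` is a cancellative semigroup with a group of fractions `G`, and the group algebra
`F[G]` is centrally essential, then the semigroup algebra `F[S]` is centrally essential. -/
theorem stmt1 (F : Type v) [Field F] (S : Type u) [Semigroup S] [IsCancelMul S]
    (G : Type w) [Group G] (φ : S →ₙ* G)
    (hinj : Function.Injective φ)
    (hfrac_right : ∀ g : G, ∃ s t : S, g = φ s * (φ t)⁻¹)
    (hfrac_left : ∀ g : G, ∃ s t : S, g = (φ s)⁻¹ * φ t)
    (h : IsCentrallyEssential (MonoidAlgebra F G)) :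
    IsCentrallyEssential (MonoidAlgebra F S) := by
  classical
  intro a ha
  let ψ : MonoidAlgebra F S →ₙ* MonoidAlgebra F G :=
    ⟨MonoidAlgebra.mapDomain φ, MonoidAlgebra.mapDomain_mul φ⟩
  have hψ : Function.Injective ψ := MonoidAlgebra.mapDomain_injective hinj
  obtain ⟨x, y, hx, hy, hx0, hy0, hxy⟩ :=
    h (ψ a) fun hc => ha (mem_center_of_map_mem_center ψ hψ hc)
  obtain ⟨z, hzc, hz⟩ := exists_central_common_denominator φ hfrac_right h.finite_range_conj
    (x.coeff.support ∪ y.coeff.support)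
  have hsc := MonoidAlgebra.single_one_mem_center (F := F) hzc
  have hne : ∀ p : MonoidAlgebra F G, p ≠ 0 → p * MonoidAlgebra.single (φ z) 1 ≠ 0 := by
    intro p hp h0
    apply hp
    have := congrArg (· * MonoidAlgebra.single (φ z)⁻¹ (1 : F)) h0
    simpa [mul_assoc, MonoidAlgebra.single_mul_single, ← MonoidAlgebra.one_def] using this
  obtain ⟨x', hx'⟩ := MonoidAlgebra.exists_mapDomain_eq_mul_single (x := x) hinj
    fun g hg => hz g (Finset.mem_union_left _ hg)
  obtain ⟨y', hy'⟩ := MonoidAlgebra.exists_mapDomain_eq_mul_single (x := y) hinj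
    fun g hg => hz g (Finset.mem_union_right _ hg)
  change ψ x' = _ at hx'
  change ψ y' = _ at hy'
  have hψ0 : ψ 0 = 0 := MonoidAlgebra.mapDomain_zero φ
  refine ⟨x', y', mem_center_of_map_mem_center ψ hψ ?_, mem_center_of_map_mem_center ψ hψ ?_,
    ?_, ?_, hψ ?_⟩
  · rw [hx']
    exact Set.mul_mem_center hx hsc
  · rw [hy']
    exact Set.mul_mem_center hy hsc
  · rintro rfl
    exact hne x hx0 (hx'.symm.trans hψ0)
  · rintro rfl
    exact hne y hy0 (hy'.symm.trans hψ0)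
  · rw [map_mul, hx', hy', ← mul_assoc, hxy]
end

section
/- There exist a field F of characteristic 0 and a semigroup S such that the semigroup algebra FS is a centrally essential ring but is not commutative. -/
namespace MonoidAlgebra

lemma single_mem_center {F S : Type*} [CommSemiring F] [Semigroup S] {s : S}
    (hs : s ∈ Set.center S) (r : F) : single s r ∈ Set.center (MonoidAlgebra F S) :=
  Semigroup.mem_center_iff.2 fun g ↦
    (single_commute (fun t ↦ (Semigroup.mem_center_iff.1 hs t).symm) (Commute.all r) g).symm

lemma mem_center_of_support_subset_center {F S : Type*} [CommSemiring F] [Semigroup S]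
    {f : MonoidAlgebra F S} (hf : ∀ s ∈ f.coeff.support, s ∈ Set.center S) :
    f ∈ Set.center (MonoidAlgebra F S) := by
  rw [← sum_coeff_single f]
  exact sum_mem (S := NonUnitalSubsemiring.center (MonoidAlgebra F S))
    fun s hs ↦ single_mem_center (hf s hs) _

lemma mul_single_mem_center {F S : Type*} [CommSemiring F] [Semigroup S] {c : S}
    (hc : ∀ t, t * c ∈ Set.center S) (f : MonoidAlgebra F S) (r : F) :
    f * single c r ∈ Set.center (MonoidAlgebra F S) := by
  induction f using induction_linear with
  | zero => simp
  | add f g hf hg => rw [add_mul]; exact Set.add_mem_center hf hg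
  | single t u => rw [single_mul_single]; exact single_mem_center (hc t) _

/-- If every noncentral `s` admits a central `c` such that `S * c` is central and `s` is the only
solution of `t * c = s * c`, then the semigroup algebra is centrally essential. -/
lemma isCentrallyEssential {F S : Type*} [CommSemiring F] [Nontrivial F] [Semigroup S]
    (h : ∀ s ∉ Set.center S, ∃ c ∈ Set.center S,
      (∀ t, t * c ∈ Set.center S) ∧ ∀ t, t * c = s * c → t = s) :
    IsCentrallyEssential (MonoidAlgebra F S) := by
  intro f hf
  obtain ⟨s, hs, hsc⟩ : ∃ s ∈ f.coeff.support, s ∉ Set.center S := by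
    by_contra! H
    exact hf (mem_center_of_support_subset_center H)
  obtain ⟨c, hc, hcS, hinj⟩ := h s hsc
  refine ⟨single c 1, f * single c 1, single_mem_center hc 1, mul_single_mem_center hcS f 1,
    single_ne_zero.2 one_ne_zero, fun h0 ↦ ?_, rfl⟩
  have key : (f * single c 1).coeff (s * c) = f.coeff s * 1 :=
    coeff_mul_single_eq_coeff_mul s fun t _ ↦ ⟨hinj t, fun e ↦ e ▸ rfl⟩
  rw [h0, mul_one] at key
  exact Finsupp.mem_support_iff.1 hs key.symm

end MonoidAlgebra

/-- A semigroup of order six, nilpotent of class three, whose only nonzero products are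
`a * b = a * c = c * a = p` and `b * c = c * b = q`. -/
inductive NilSemigroup : Type
  | zero | a | b | c | p | q

namespace NilSemigroup

/-- The multiplication of `NilSemigroup`. -/
def mul : NilSemigroup → NilSemigroup → NilSemigroup
  | a, b => p
  | a, c => p
  | c, a => p
  | b, c => q
  | c, b => q
  | _, _ => zero

instance : Semigroup NilSemigroup where
  mul := mul
  mul_assoc x y z := by cases x <;> cases y <;> cases z <;> rfl

lemma mul_def (x y : NilSemigroup) : x * y = mul x y := rfl

lemma mem_center_iff {x : NilSemigroup} : x ∈ Set.center NilSemigroup ↔ x ≠ a ∧ x ≠ b := by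
  rw [Semigroup.mem_center_iff]
  constructor
  · intro h
    constructor
    · rintro rfl
      exact absurd (h b) (by simp [mul_def, mul])
    · rintro rfl
      exact absurd (h a) (by simp [mul_def, mul])
  · rintro ⟨ha, hb⟩ y
    cases x <;> first | contradiction | (cases y <;> rfl)

lemma exists_central_mul_cancel (s : NilSemigroup) (hs : s ∉ Set.center NilSemigroup) :
    ∃ z ∈ Set.center NilSemigroup,
      (∀ t, t * z ∈ Set.center NilSemigroup) ∧ ∀ t, t * z = s * z → t = s := by
  refine ⟨c, by simp [mem_center_iff], fun t ↦ ?_, fun t ↦ ?_⟩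
  · cases t <;> simp [mem_center_iff, mul_def, mul]
  · cases s <;> simp [mem_center_iff] at hs <;> cases t <;> simp [mul_def, mul]

end NilSemigroup

/-- There exist a field `F` of characteristic `0` and a semigroup `S` such that the
semigroup algebra `F[S]` is centrally essential but not commutative. -/
theorem stmt2 :
    ∃ (F : Type) (_ : Field F) (S : Type) (_ : Semigroup S),
      CharZero F ∧ IsCentrallyEssential (MonoidAlgebra F S) ∧
        ∃ a b : MonoidAlgebra F S, a * b ≠ b * a := by
  refine ⟨ℚ, inferInstance, NilSemigroup, inferInstance, inferInstance,
    MonoidAlgebra.isCentrallyEssential NilSemigroup.exists_central_mul_cancel,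
    .single .a 1, .single .b 1, ?_⟩
  simp [MonoidAlgebra.single_inj, NilSemigroup.mul_def, NilSemigroup.mul]
end

section
/- Let F be a field and let S be a cancellative semigroup such that the semigroup algebra FS is a centrally essential ring. Then FS has a classical right ring of fractions Q, and Q is a centrally essential ring. -/
/-- An element `r` is a (two-sided) non-zero-divisor. -/
def IsNonZeroDivisor {R : Type*} [NonUnitalNonAssocSemiring R] (r : R) : Prop :=
  (∀ x : R, r * x = 0 → x = 0) ∧ (∀ x : R, x * r = 0 → x = 0)

/-- `Q` (together with the injective ring homomorphism `φ : R → Q`) is a classical right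
ring of fractions of `R`: every non-zero-divisor of `R` becomes invertible in `Q`, and
every element of `Q` has the form `φ a * (φ b)⁻¹` with `b` a non-zero-divisor of `R`. -/
structure IsClassicalRightRingOfFractions (R : Type*) [NonUnitalNonAssocSemiring R]
    (Q : Type*) [Ring Q] (φ : R →ₙ+* Q) : Prop where
  inj : Function.Injective φ
  isUnit : ∀ b : R, IsNonZeroDivisor b → IsUnit (φ b)
  num_denom : ∀ q : Q, ∃ a b : R, IsNonZeroDivisor b ∧ q * φ b = φ a

universe u

open Function OreLocalization

section RingOfFractions

theorem IsNonZeroDivisor.mul {R : Type*} [NonUnitalSemiring R] {a b : R}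
    (ha : IsNonZeroDivisor a) (hb : IsNonZeroDivisor b) : IsNonZeroDivisor (a * b) :=
  ⟨fun x hx => hb.1 x (ha.1 _ (by rw [← mul_assoc, hx])),
    fun x hx => ha.2 x (hb.2 _ (by rw [mul_assoc, hx]))⟩

/-- The submonoid of central non-zero-divisors of a ring. -/
def centralNonZeroDivisors (A : Type*) [Ring A] : Submonoid A where
  carrier := {a | a ∈ Set.center A ∧ IsNonZeroDivisor a}
  mul_mem' ha hb := ⟨Set.mul_mem_center ha.1 hb.1, ha.2.mul hb.2⟩
  one_mem' := ⟨Set.one_mem_center, fun x hx => by simpa using hx, fun x hx => by simpa using hx⟩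

/-- Central non-zero-divisors satisfy the Ore condition. -/
instance oreSetCentralNonZeroDivisors (A : Type*) [Ring A] :
    OreLocalization.OreSet (centralNonZeroDivisors A) where
  ore_right_cancel r₁ r₂ s h :=
    ⟨s, by rw [(s.2.1.comm r₁).eq, (s.2.1.comm r₂).eq, h]⟩
  oreNum r _ := r
  oreDenom _ s := s
  ore_eq r s := (s.2.1.comm r).eq

/-- Inverting the central non-zero-divisors of an overring `A` of `R` yields a centrally essential
classical right ring of fractions of `R`, provided that every non-zero-divisor of `R` divides a
central non-zero-divisor of `A` and that `A * z` lies in `R` for some central non-zero-divisor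
`z` of `A` belonging to `R`. -/
theorem exists_classicalRightRingOfFractions {R A : Type u} [NonUnitalRing R] [Ring A]
    (i : R →ₙ+* A) (hi : Injective i) (hce : IsCentrallyEssential R)
    (hdvd : ∀ b, IsNonZeroDivisor b → ∃ c, i b * c ∈ centralNonZeroDivisors A)
    (z : R) (hz : i z ∈ centralNonZeroDivisors A) (hAz : ∀ r, ∃ r', i r' = r * i z) :
    ∃ (Q : Type u) (_ : Ring Q) (φ : R →ₙ+* Q),
      IsClassicalRightRingOfFractions R Q φ ∧ IsCentrallyEssential Q := by
  let P := centralNonZeroDivisors A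
  let ν : A →+* OreLocalization P A := OreLocalization.numeratorRingHom
  have hν : Injective ν := OreLocalization.numeratorHom_inj fun s hs x hx => hs.2.1 x hx
  have hunit (s : A) (hs : s ∈ P) : IsUnit (ν s) := OreLocalization.numerator_isUnit ⟨s, hs⟩
  have hdiv (r : A) (s : P) : ν s * (r /ₒ s) = ν r := by
    change (s : A) /ₒ (1 : P) * (r /ₒ s) = r /ₒ 1
    exact OreLocalization.mul_cancel
  have hcenter (x : A) (hx : x ∈ Set.center A) : ν x ∈ Set.center (OreLocalization P A) := by
    have hx' (r : A) : ν r * ν x = ν x * ν r := by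
      rw [← map_mul, ← map_mul, Semigroup.mem_center_iff.1 hx r]
    rw [Semigroup.mem_center_iff]
    intro q
    induction q using OreLocalization.ind with | _ r s
    refine (hunit s s.2).mul_left_cancel ?_
    rw [← mul_assoc, hdiv, ← mul_assoc, hx', hx', mul_assoc, hdiv]
  have hfrac (q : OreLocalization P A) : ∃ a b, i b ∈ P ∧ q * ν (i b) = ν (i a) := by
    induction q using OreLocalization.ind with | _ r s
    obtain ⟨a, ha⟩ := hAz r
    obtain ⟨b, hb⟩ := hAz s
    refine ⟨a, b, hb ▸ P.mul_mem s.2 hz, ?_⟩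
    rw [hb, map_mul, ← mul_assoc, ← ((hcenter s s.2.1).comm _).eq, hdiv, ← map_mul, ha]
  have hcenterR (x : R) (hx : x ∈ Set.center R) : i x ∈ Set.center A := by
    rw [Semigroup.mem_center_iff] at hx ⊢
    intro r
    obtain ⟨r', hr⟩ := hAz r
    have : (r * i x - i x * r) * i z = 0 := by
      rw [sub_mul, mul_assoc, mul_assoc, ← hr, ← (hz.1.comm (i x)).eq, ← mul_assoc, ← hr,
        ← map_mul, ← map_mul, hx r', sub_self]
    exact sub_eq_zero.1 (hz.2.2 _ this)
  have hreg (b : R) (hb : i b ∈ P) : IsNonZeroDivisor b :=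
    ⟨fun x hx => hi (by rw [map_zero]; exact hb.2.1 _ (by rw [← map_mul, hx, map_zero])),
      fun x hx => hi (by rw [map_zero]; exact hb.2.2 _ (by rw [← map_mul, hx, map_zero]))⟩
  refine ⟨OreLocalization P A, inferInstance, (ν : A →ₙ+* OreLocalization P A).comp i,
    ⟨hν.comp hi, fun b hb => ?_, fun q => ?_⟩, fun q hq => ?_⟩
  · obtain ⟨c, hc⟩ := hdvd b hb
    have hbA (x : A) (hx : i b * x = 0) : x = 0 := by
      obtain ⟨x', hx'⟩ := hAz x
      refine hz.2.2 _ ?_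
      have : b * x' = 0 := hi (by rw [map_mul, hx', ← mul_assoc, hx, zero_mul, map_zero])
      rw [← hx', hb.1 _ this, map_zero]
    have hcomm : i b * c = c * i b := by
      refine (sub_eq_zero.1 (hbA _ ?_))
      rw [mul_sub, ← mul_assoc (i b) c, (hc.1.comm (i b)).eq, sub_self]
    have : Commute (ν (i b)) (ν c) := by
      rw [Commute, SemiconjBy, ← map_mul, ← map_mul, hcomm]
    exact (this.isUnit_mul_iff.1 (map_mul ν (i b) c ▸ hunit _ hc)).1
  · obtain ⟨a, b, hb, h⟩ := hfrac q
    exact ⟨a, b, hreg b hb, h⟩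
  · obtain ⟨a, b, hb, h⟩ := hfrac q
    have ha : a ∉ Set.center R := by
      refine fun ha => hq ?_
      have h1 := hcenter _ (hcenterR a ha)
      rw [← h] at h1
      rw [Semigroup.mem_center_iff] at h1 ⊢
      intro g
      refine (hunit _ hb).mul_right_cancel ?_
      rw [mul_assoc, h1 g, mul_assoc, mul_assoc, ((hcenter _ hb.1).comm g).eq]
    obtain ⟨x, y, hx, hy, hx0, hy0, hxy⟩ := hce a ha
    refine ⟨ν (i b * i x), ν (i y), hcenter _ (Set.mul_mem_center hb.1 (hcenterR x hx)),
      hcenter _ (hcenterR y hy), ?_, ?_, ?_⟩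
    · rw [map_ne_zero_iff ν hν]
      exact fun h0 => hx0 (hi (by rw [hb.2.1 _ h0, map_zero]))
    · rw [map_ne_zero_iff ν hν, map_ne_zero_iff i hi]
      exact hy0
    · rw [map_mul, ← mul_assoc, h, ← map_mul, ← map_mul, hxy]

end RingOfFractions

/-- A cancellative semigroup embeds into a cancellative monoid with at most one additional
element. -/
theorem exists_cancelMonoid_embedding (S : Type u) [Semigroup S] [IsCancelMul S] :
    ∃ (M : Type u) (_ : CancelMonoid M) (ι : S →ₙ* M),
      Injective ι ∧ ∀ m, m = 1 ∨ m ∈ Set.range ι := by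
  by_cases h : ∃ e : S, ∀ s, e * s = s
  · obtain ⟨e, he⟩ := h
    have he' (s : S) : s * e = s := mul_right_cancel (b := e) (by rw [mul_assoc, he])
    exact ⟨S, { ‹Semigroup S›, ‹IsCancelMul S› with one := e, one_mul := he, mul_one := he' },
      MulHom.id S, injective_id, fun m => .inr ⟨m, rfl⟩⟩
  · push Not at h
    have hl (s e : S) : e * s ≠ s := by
      intro hs
      obtain ⟨t, ht⟩ := h e
      refine ht ?_
      have h1 : s * e = s := mul_right_cancel (b := s) (by rw [mul_assoc, hs])
      exact mul_left_cancel (a := s) (by rw [← mul_assoc, h1])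
    have hr (s e : S) : s * e ≠ s := by
      intro hs
      refine hl s e (mul_left_cancel (a := s) (by rw [← mul_assoc, hs]))
    let inst : IsCancelMul (WithOne S) :=
      { mul_left_cancel := fun a b c (hbc : a * b = a * c) => by
          cases a <;> cases b <;> cases c <;>
            simp_all [← WithOne.coe_mul, WithOne.coe_inj]
          · exact hr _ _ hbc.symm
        mul_right_cancel := fun a b c (hbc : b * a = c * a) => by
          cases a <;> cases b <;> cases c <;>
            simp_all [← WithOne.coe_mul, WithOne.coe_inj]
          · exact hl _ _ hbc.symm }
    refine ⟨WithOne S, { (inferInstance : Monoid (WithOne S)), inst with }, WithOne.coeMulHom,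
      WithOne.coe_injective, fun m => ?_⟩
    cases m
    · exact .inl rfl
    · exact .inr ⟨_, rfl⟩

theorem exists_le_count_of_card_mul_lt {α : Type*} [DecidableEq α] (T : Finset α) (w : List α)
    (hw : ∀ x ∈ w, x ∈ T) (N : ℕ) (h : T.card * N < w.length) : ∃ t ∈ T, N ≤ w.count t := by
  by_contra! hc
  have h1 : ∑ t ∈ T, w.count t = w.length := by
    simpa using Multiset.sum_count_eq_card (s := T) (m := (w : Multiset α)) (by simpa using hw)
  have h2 : ∑ t ∈ T, w.count t ≤ ∑ t ∈ T, N := Finset.sum_le_sum fun t ht => (hc t ht).le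
  rw [h1, Finset.sum_const, smul_eq_mul] at h2
  omega

section FiniteClasses

variable {M : Type u} [CancelMonoid M]

/-- A finite subset `T` of a monoid is conjugation stable if `m * T ⊆ T * m` for all `m`. -/
def ConjStable (T : Finset M) : Prop :=
  ∀ m, ∀ t ∈ T, ∃ t' ∈ T, m * t = t' * m

/-- An element has a finite conjugacy class if it belongs to a finite conjugation stable set. -/
def HasFiniteClass (t : M) : Prop :=
  ∃ T : Finset M, t ∈ T ∧ ConjStable T

theorem HasFiniteClass.mul {s t : M} (hs : HasFiniteClass s) (ht : HasFiniteClass t) :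
    HasFiniteClass (s * t) := by
  classical
  obtain ⟨A, hsA, hA⟩ := hs
  obtain ⟨B, htB, hB⟩ := ht
  refine ⟨Finset.image₂ (· * ·) A B, Finset.mem_image₂_of_mem hsA htB, fun m x hx => ?_⟩
  obtain ⟨a, ha, b, hb, rfl⟩ := Finset.mem_image₂.1 hx
  obtain ⟨a', ha', h1⟩ := hA m a ha
  obtain ⟨b', hb', h2⟩ := hB m b hb
  refine ⟨a' * b', Finset.mem_image₂_of_mem ha' hb', ?_⟩
  rw [← mul_assoc, h1, mul_assoc, h2, mul_assoc]

theorem exists_conjStable_superset (B : Finset M) (hB : ∀ b ∈ B, HasFiniteClass b) :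
    ∃ T : Finset M, B ⊆ T ∧ ConjStable T := by
  classical
  choose! T hT hst using hB
  refine ⟨B.biUnion T, fun b hb => Finset.mem_biUnion.2 ⟨b, hb, hT b hb⟩, fun m t ht => ?_⟩
  obtain ⟨b, hb, htb⟩ := Finset.mem_biUnion.1 ht
  obtain ⟨t', ht', h⟩ := hst b hb m t htb
  exact ⟨t', Finset.mem_biUnion.2 ⟨b, hb, ht'⟩, h⟩

theorem HasFiniteClass.exists_commute_pow {t : M} (ht : HasFiniteClass t) (r : M) :
    ∃ n, 0 < n ∧ Commute (r ^ n) t := by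
  obtain ⟨T, htT, hT⟩ := ht
  choose f hf hrf using fun x : T => hT r x x.2
  let g : T → T := fun x => ⟨f x, hf x⟩
  have hg : Injective g := fun x y hxy => by
    have : f x = f y := congrArg Subtype.val hxy
    exact Subtype.ext (mul_left_cancel (a := r) (by rw [hrf, hrf, this]))
  have hpow (n : ℕ) (x : T) : r ^ n * x = g^[n] x * r ^ n := by
    induction n generalizing x with
    | zero => simp
    | succ n ih =>
      rw [pow_succ, mul_assoc, hrf, ← mul_assoc, ih ⟨f x, hf x⟩, mul_assoc, iterate_succ_apply]
  obtain ⟨n, hn, hper⟩ := mem_periodicPts.1 (hg.mem_periodicPts ⟨t, htT⟩)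
  refine ⟨n, hn, ?_⟩
  have := hpow n ⟨t, htT⟩
  rwa [hper] at this

/-- If every element of `M` becomes of finite class after multiplication by an element of finite
class, then any two elements commute up to replacing one of them by a power. -/
theorem exists_pow_commute
    (hM : ∀ s : M, ∃ a, HasFiniteClass a ∧ HasFiniteClass (s * a)) (t r : M) :
    ∃ n, 0 < n ∧ Commute (t ^ n) r := by
  obtain ⟨a, ha, hra⟩ := hM r
  obtain ⟨k, hk, h1⟩ := ha.exists_commute_pow t
  obtain ⟨l, hl, h2⟩ := hra.exists_commute_pow t
  refine ⟨k * l, Nat.mul_pos hk hl, mul_right_cancel (b := a) ?_⟩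
  have h3 : Commute (t ^ (k * l)) a := by rw [pow_mul]; exact h1.pow_left l
  have h4 : Commute (t ^ (k * l)) (r * a) := by
    rw [mul_comm, pow_mul]; exact h2.pow_left k
  rw [mul_assoc, h4.eq, mul_assoc, mul_assoc, h3.eq]

theorem HasFiniteClass.exists_pow_mem_center
    (hM : ∀ s : M, ∃ a, HasFiniteClass a ∧ HasFiniteClass (s * a)) {t : M}
    (ht : HasFiniteClass t) : ∃ n, 0 < n ∧ t ^ n ∈ Submonoid.center M := by
  obtain ⟨T, htT, hT⟩ := ht
  have key (τ : M) : ∃ k, 0 < k ∧ ((∃ r, r * t = τ * r) → t ^ k = τ ^ k) := by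
    by_cases h : ∃ r, r * t = τ * r
    · obtain ⟨r, hr⟩ := h
      obtain ⟨k, hk, hc⟩ := exists_pow_commute hM t r
      refine ⟨k, hk, fun _ => mul_right_cancel (b := r) ?_⟩
      rw [hc.eq]
      exact SemiconjBy.pow_right (show SemiconjBy r t τ from hr) k
    · exact ⟨1, one_pos, fun h' => absurd h' h⟩
  choose k hk hpow using key
  refine ⟨∏ τ ∈ T, k τ, Finset.prod_pos fun τ _ => hk τ, Submonoid.mem_center_iff.2 fun r => ?_⟩
  obtain ⟨τ, hτ, h⟩ := hT r t htT
  obtain ⟨l, hl⟩ := Finset.dvd_prod_of_mem k hτ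
  have h1 : r * t ^ (∏ τ ∈ T, k τ) = τ ^ (∏ τ ∈ T, k τ) * r :=
    SemiconjBy.pow_right (show SemiconjBy r t τ from h) _
  rw [h1, hl, pow_mul, pow_mul, hpow τ ⟨r, h⟩]

theorem exists_forall_mul_hasFiniteClass
    (hM : ∀ s : M, ∃ a, HasFiniteClass a ∧ HasFiniteClass (s * a)) (B : Finset M) :
    ∃ a, HasFiniteClass a ∧ ∀ s ∈ B, HasFiniteClass (s * a) := by
  classical
  induction B using Finset.induction_on with
  | empty =>
    obtain ⟨a, ha, -⟩ := hM 1
    exact ⟨a, ha, by simp⟩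
  | insert s B _ ih =>
    obtain ⟨a, ha, hB⟩ := ih
    obtain ⟨a', hfin, hs⟩ := hM (s * a)
    refine ⟨a * a', ha.mul hfin, fun x hx => ?_⟩
    rw [← mul_assoc]
    rcases Finset.mem_insert.1 hx with rfl | hx
    · exact hs
    · exact (hB x hx).mul hfin

/-- In a conjugation stable set, a word in which `t` occurs at least `k` times can be rewritten
with a factor `t ^ k` on the right. -/
theorem ConjStable.exists_prod_eq_mul_pow [DecidableEq M] {T : Finset M} (hT : ConjStable T)
    (t : M) (w : List M) (hw : ∀ x ∈ w, x ∈ T) (k : ℕ) (hk : k ≤ w.reverse.count t) :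
    ∃ w' : List M, (∀ x ∈ w', x ∈ T) ∧ w'.length + k = w.length ∧
      w.reverse.prod = w'.reverse.prod * t ^ k := by
  induction w generalizing k with
  | nil => exact ⟨[], by simp, by simp_all, by simp_all⟩
  | cons σ u ih =>
    have hu : ∀ x ∈ u, x ∈ T := fun x hx => hw x (List.mem_cons_of_mem _ hx)
    by_cases hσ : σ = t
    · subst hσ
      cases k with
      | zero => exact ⟨σ :: u, hw, by simp, by simp⟩
      | succ k =>
        obtain ⟨w', h1, h2, h3⟩ := ih hu k (by simpa using hk)
        refine ⟨w', h1, by simp; omega, ?_⟩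
        rw [List.reverse_cons, List.prod_append, h3, List.prod_singleton, mul_assoc, ← pow_succ]
    · obtain ⟨w', h1, h2, h3⟩ := ih hu k (by
        simpa [List.count_cons, hσ] using hk)
      obtain ⟨σ', hσ', h4⟩ := hT (t ^ k) σ (hw σ (by simp))
      refine ⟨σ' :: w', ?_, by simp; omega, ?_⟩
      · intro x hx
        rcases List.mem_cons.1 hx with rfl | hx
        · exact hσ'
        · exact h1 x hx
      · simp only [List.reverse_cons, List.prod_append, List.prod_singleton]
        rw [h3, mul_assoc, h4, mul_assoc]

end FiniteClasses

section FreeCentral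

/-- Every cancellative commutative additive monoid contains a free submonoid over which all
elements are algebraic. -/
theorem exists_linearCombination_injective (A : Type*) [AddCommMonoid A] [IsCancelAdd A] :
    ∃ s : Set A, Injective (Finsupp.linearCombination ℕ ((↑) : s → A)) ∧
      ∀ z : A, ∃ l, 0 < l ∧ ∃ α β : s →₀ ℕ,
        Finsupp.linearCombination ℕ (↑) α + l • z = Finsupp.linearCombination ℕ (↑) β := by
  classical
  obtain ⟨s, hs, hmax⟩ := exists_maximal_linearIndepOn' ℕ (id : A → A)
  refine ⟨s, hs, fun z => ?_⟩
  by_cases hz : z ∈ s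
  · exact ⟨1, one_pos, 0, Finsupp.single ⟨z, hz⟩ 1, by simp⟩
  have hdep : ¬ LinearIndepOn ℕ (id : A → A) (insert z s) := fun hi =>
    hz (hmax _ (Set.subset_insert z s) hi ▸ Set.mem_insert z s)
  rw [linearIndepOn_iffₛ] at hs hdep
  push Not at hdep
  obtain ⟨f, hf, g, hg, hfg, hne⟩ := hdep
  have hsupp (f : A →₀ ℕ) (hf : f ∈ Finsupp.supported ℕ ℕ (insert z s)) :
      f.erase z ∈ Finsupp.supported ℕ ℕ s := by
    intro x hx
    rw [Finset.mem_coe, Finsupp.support_erase, Finset.mem_erase] at hx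
    exact (hf hx.2).resolve_left hx.1
  have hrepr (f : A →₀ ℕ) (hf : f ∈ Finsupp.supported ℕ ℕ s) :
      ∃ α : s →₀ ℕ, Finsupp.linearCombination ℕ (↑) α = Finsupp.linearCombination ℕ id f := by
    rw [← Finsupp.mem_span_iff_linearCombination, Finsupp.linearCombination_apply]
    exact Submodule.sum_mem _ fun x hx => Submodule.smul_mem _ _ (Submodule.subset_span (hf hx))
  have hsplit (f : A →₀ ℕ) : Finsupp.linearCombination ℕ id f =
      Finsupp.linearCombination ℕ id (f.erase z) + f z • z := by
    conv_lhs => rw [← Finsupp.erase_add_single z f]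
    simp
  wlog hle : f z ≤ g z generalizing f g
  · exact this g hg f hf hfg.symm hne.symm (not_le.1 hle).le
  obtain ⟨α, hα⟩ := hrepr _ (hsupp f hf)
  obtain ⟨β, hβ⟩ := hrepr _ (hsupp g hg)
  obtain ⟨l, hl⟩ := Nat.exists_eq_add_of_le hle
  have heq : Finsupp.linearCombination ℕ id (f.erase z) =
      Finsupp.linearCombination ℕ id (g.erase z) + l • z := by
    refine add_right_cancel (b := f z • z) ?_
    rw [← hsplit, hfg, hsplit, hl, add_smul, add_assoc, add_comm (l • z)]
  refine ⟨l, ?_, β, α, by rw [hα, hβ, heq]⟩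
  rw [Nat.pos_iff_ne_zero]
  rintro rfl
  refine hne ?_
  rw [← Finsupp.erase_add_single z f, ← Finsupp.erase_add_single z g, hl, add_zero,
    hs _ (hsupp f hf) _ (hsupp g hg) (by simpa using heq)]

theorem exists_free_central (M : Type u) [CancelMonoid M] :
    ∃ (σ : Type u) (e : Multiplicative (σ →₀ ℕ) →* M), Injective e ∧
      (∀ α, e α ∈ Submonoid.center M) ∧
      ∀ z ∈ Submonoid.center M, ∃ l, 0 < l ∧ ∃ α β, e α * z ^ l = e β := by
  obtain ⟨s, hinj, hs⟩ := exists_linearCombination_injective (Additive (Submonoid.center M))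
  refine ⟨s, (Submonoid.center M).subtype.comp (AddMonoidHom.toMultiplicativeLeft
    (Finsupp.linearCombination ℕ ((↑) : s → Additive (Submonoid.center M))).toAddMonoidHom), ?_,
    fun α => Subtype.prop _, fun z hz => ?_⟩
  · exact Subtype.val_injective.comp (Additive.toMul.injective.comp
      (hinj.comp Multiplicative.toAdd.injective))
  · obtain ⟨l, hl, α, β, h⟩ := hs (.ofMul ⟨z, hz⟩)
    exact ⟨l, hl, .ofAdd α, .ofAdd β, congrArg (fun x => (x.toMul : M)) h⟩

end FreeCentral

section Regularity

variable {M σ : Type*} [CancelMonoid M]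

open MonoidAlgebra in
/-- Nonzero elements of the algebra of a free commutative submonoid of the center of a cancellative
monoid are non-zero-divisors. -/
theorem mapDomain_mul_ne_zero {F : Type*} [Field F] {e : Multiplicative (σ →₀ ℕ) →* M}
    (he : Injective e) (hc : ∀ α, e α ∈ Submonoid.center M)
    {c : MonoidAlgebra F (Multiplicative (σ →₀ ℕ))} (h0 : c ≠ 0) {r : MonoidAlgebra F M}
    (hr : r ≠ 0) : mapDomainRingHom F e c * r ≠ 0 := by
  classical
  obtain ⟨s₀, hs₀⟩ : r.coeff.support.Nonempty := by
    simpa [Finsupp.support_nonempty_iff] using hr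
  let κ : Multiplicative (σ →₀ ℕ) → (σ →₀ ℤ) :=
    fun α => Finsupp.mapRange.addMonoidHom (Nat.castAddMonoidHom ℤ) α.toAdd
  have hκ : Injective κ := (Finsupp.mapRange_injective _ (by simp) Nat.cast_injective).comp
    Multiplicative.toAdd.injective
  have hκmul (α β) : κ (α * β) = κ α + κ β :=
    map_add (Finsupp.mapRange.addMonoidHom (Nat.castAddMonoidHom ℤ)) α.toAdd β.toAdd
  let B := {s ∈ r.coeff.support | ∃ α β, e α * s = e β * s₀}
  have hex (s : M) : ∃ w : σ →₀ ℤ, (∃ α β, e α * s = e β * s₀) →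
      ∃ α β, e α * s = e β * s₀ ∧ w = κ β - κ α := by
    by_cases h : ∃ α β, e α * s = e β * s₀
    · obtain ⟨α, β, h⟩ := h
      exact ⟨_, fun _ => ⟨α, β, h, rfl⟩⟩
    · exact ⟨0, fun h' => absurd h' h⟩
  choose w hw using hex
  have hshift (a b : Multiplicative (σ →₀ ℕ)) (s t : M) (ht : ∃ α β, e α * t = e β * s₀)
      (h : e a * s = e b * t) :
      (∃ α β, e α * s = e β * s₀) ∧ κ a + w s = κ b + w t := by
    obtain ⟨α, β, h1, h2⟩ := hw t ht
    have h3 : e (α * a) * s = e (b * β) * s₀ := by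
      rw [map_mul, mul_assoc, h, ← mul_assoc, Submonoid.mem_center_iff.1 (hc b), mul_assoc, h1,
        map_mul, mul_assoc]
    refine ⟨⟨_, _, h3⟩, ?_⟩
    obtain ⟨α', β', h4, h5⟩ := hw s ⟨_, _, h3⟩
    have h6 : e (β' * (α * a)) = e (α' * (b * β)) := by
      refine mul_right_cancel (b := s₀) ?_
      rw [mul_comm β', map_mul e (α * a), mul_assoc, ← h4, ← mul_assoc, ← map_mul, mul_comm _ α',
        map_mul, mul_assoc, h3, ← mul_assoc, ← map_mul]
    have h7 := congrArg κ (he h6)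
    simp only [hκmul] at h7
    rw [h2, h5, ← sub_eq_zero]
    rw [← sub_eq_zero] at h7
    rw [← h7]
    abel
  have hwinj (s t : M) (hs : ∃ α β, e α * s = e β * s₀) (ht : ∃ α β, e α * t = e β * s₀)
      (hst : w s = w t) : s = t := by
    obtain ⟨α, β, h1, h2⟩ := hw s hs
    obtain ⟨α', β', h3, h4⟩ := hw t ht
    have h5 : α' * β = α * β' := hκ (by
      rw [h2, h4, ← sub_eq_zero] at hst
      rw [hκmul, hκmul, ← sub_eq_zero, ← hst]
      abel)
    refine mul_left_cancel (a := e (α' * α)) ?_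
    rw [map_mul, mul_assoc, h1, ← mul_assoc, ← map_mul, h5, map_mul, mul_assoc, ← h3, ← mul_assoc,
      ← map_mul, mul_comm, map_mul]
  have hs₀B : s₀ ∈ B := Finset.mem_filter.2 ⟨hs₀, 1, 1, rfl⟩
  obtain ⟨_, hα, _, hs, huniq⟩ := UniqueSums.uniqueAdd_of_nonempty
    (A := c.coeff.support.image κ) (B := B.image w)
    (by simpa [Finsupp.support_nonempty_iff] using h0) (Finset.Nonempty.image ⟨s₀, hs₀B⟩ w)
  obtain ⟨α, hαc, rfl⟩ := Finset.mem_image.1 hα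
  obtain ⟨s, hsB, rfl⟩ := Finset.mem_image.1 hs
  have hcoeff : (mapDomainRingHom F e c).coeff = Finsupp.mapDomain e c.coeff := by
    rw [mapDomainRingHom_apply, coeff_mapDomain]
  have hunique : UniqueMul (mapDomainRingHom F e c).coeff.support r.coeff.support (e α) s := by
    intro x t hx ht h
    rw [hcoeff, Finsupp.mapDomain_support_of_injective he] at hx
    obtain ⟨β, hβ, rfl⟩ := Finset.mem_image.1 hx
    obtain ⟨h1, h2⟩ := hshift β α t s (Finset.mem_filter.1 hsB).2 h
    obtain ⟨h3, h4⟩ := huniq (Finset.mem_image_of_mem _ hβ)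
      (Finset.mem_image_of_mem _ (Finset.mem_filter.2 ⟨ht, h1⟩)) h2
    exact ⟨by rw [hκ h3], hwinj t s h1 (Finset.mem_filter.1 hsB).2 h4⟩
  intro h
  have := coeff_mul_mul_of_uniqueMul hunique
  rw [h, hcoeff, Finsupp.mapDomain_apply he] at this
  exact mul_ne_zero (Finsupp.mem_support_iff.1 hαc)
    (Finsupp.mem_support_iff.1 (Finset.mem_filter.1 hsB).1) this.symm

end Regularity

section AlgebraicElements

open MonoidAlgebra

variable {M σ : Type*} [CancelMonoid M] {e : Multiplicative (σ →₀ ℕ) →* M}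

theorem ConjStable.exists_pow_mem_range {T : Finset M} (hT : ConjStable T)
    (hM : ∀ s : M, ∃ a, HasFiniteClass a ∧ HasFiniteClass (s * a))
    (hc : ∀ α, e α ∈ Submonoid.center M)
    (halg : ∀ z ∈ Submonoid.center M, ∃ l, 0 < l ∧ ∃ α β, e α * z ^ l = e β) :
    ∃ N, 0 < N ∧ ∀ t ∈ T, ∃ α β, e α * t ^ N = e β := by
  have key (t : M) : ∃ k, 0 < k ∧ (t ∈ T → ∃ α β, e α * t ^ k = e β) := by
    by_cases ht : t ∈ T
    · obtain ⟨n, hn, h⟩ := HasFiniteClass.exists_pow_mem_center hM ⟨T, ht, hT⟩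
      obtain ⟨l, hl, α, β, h⟩ := halg _ h
      exact ⟨n * l, Nat.mul_pos hn hl, fun _ => ⟨α, β, by rw [pow_mul, h]⟩⟩
    · exact ⟨1, one_pos, fun h => absurd h ht⟩
  choose k hk h using key
  refine ⟨∏ t ∈ T, k t, Finset.prod_pos fun t _ => hk t, fun t ht => ?_⟩
  obtain ⟨m, hm⟩ := Finset.dvd_prod_of_mem k ht
  obtain ⟨α, β, h⟩ := h t ht
  have hcomm : Commute (e α) (t ^ k t) := (Submonoid.mem_center_iff.1 (hc α) _).symm
  exact ⟨α ^ m, β ^ m, by rw [hm, pow_mul, map_pow, map_pow, ← hcomm.mul_pow, h]⟩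

/-- Up to multiplication by elements of the range of `e`, every word in `T` is equal to a word of
bounded length. -/
theorem ConjStable.exists_length_le {T : Finset M} (hT : ConjStable T)
    (hc : ∀ α, e α ∈ Submonoid.center M) {N : ℕ} (hN : 0 < N)
    (hpow : ∀ t ∈ T, ∃ α β, e α * t ^ N = e β) (w : List M) (hw : ∀ x ∈ w, x ∈ T) :
    ∃ α β, ∃ w' : List M, (∀ x ∈ w', x ∈ T) ∧ w'.length ≤ T.card * N ∧
      e α * w.reverse.prod = e β * w'.reverse.prod := by
  classical
  induction hn : w.length using Nat.strong_induction_on generalizing w with | _ n ih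
  subst hn
  by_cases hle : w.length ≤ T.card * N
  · exact ⟨1, 1, w, hw, hle, rfl⟩
  obtain ⟨t, ht, hcount⟩ := exists_le_count_of_card_mul_lt T w.reverse (by simpa using hw) N
    (by simpa using hle)
  obtain ⟨u, hu, hlen, heq⟩ := hT.exists_prod_eq_mul_pow t w hw N hcount
  obtain ⟨α, β, w', hw', hle', h⟩ := ih u.length (by omega) u hu rfl
  obtain ⟨α', β', h'⟩ := hpow t ht
  refine ⟨α * α', β * β', w', hw', hle', ?_⟩
  rw [heq, map_mul, mul_assoc, ← mul_assoc (e α'), ← Submonoid.mem_center_iff.1 (hc α'),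
    mul_assoc, h', ← mul_assoc, h, mul_assoc, Submonoid.mem_center_iff.1 (hc β'), ← mul_assoc,
    map_mul]

theorem ConjStable.exists_finset {T : Finset M} (hT : ConjStable T)
    (hM : ∀ s : M, ∃ a, HasFiniteClass a ∧ HasFiniteClass (s * a))
    (hc : ∀ α, e α ∈ Submonoid.center M)
    (halg : ∀ z ∈ Submonoid.center M, ∃ l, 0 < l ∧ ∃ α β, e α * z ^ l = e β) :
    ∃ W : Finset M, ∀ m ∈ Submonoid.closure (T : Set M), ∃ α β, ∃ w ∈ W, e α * m = e β * w := by
  classical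
  obtain ⟨N, hN, hpow⟩ := hT.exists_pow_mem_range hM hc halg
  let W := (fun l : List T => (l.map Subtype.val).reverse.prod) '' {l | l.length ≤ T.card * N}
  have hW : W.Finite := (List.finite_length_le T _).image _
  refine ⟨hW.toFinset, fun m hm => ?_⟩
  obtain ⟨l, hl, rfl⟩ := Submonoid.exists_list_of_mem_closure hm
  obtain ⟨α, β, w', hw', hle, h⟩ := hT.exists_length_le hc hN hpow l.reverse (by simpa using hl)
  lift w' to List T using hw'
  refine ⟨α, β, _, hW.mem_toFinset.2 ⟨w', by simpa using hle, rfl⟩, by simpa using h⟩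

variable {F : Type*} [Field F]

theorem commute_mapDomain (hc : ∀ α, e α ∈ Submonoid.center M)
    (c : MonoidAlgebra F (Multiplicative (σ →₀ ℕ))) (x : MonoidAlgebra F M) :
    Commute (mapDomainRingHom F e c) x := by
  induction c using MonoidAlgebra.induction_linear with
  | zero => simp
  | add f g hf hg => rw [map_add]; exact hf.add_left hg
  | single α r =>
    induction x using MonoidAlgebra.induction_linear with
    | zero => simp
    | add f g hf hg => exact hf.add_right hg
    | single m s =>
      rw [mapDomainRingHom_apply, mapDomain_single]
      rw [Commute, SemiconjBy, single_mul_single, single_mul_single, mul_comm r,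
        Submonoid.mem_center_iff.1 (hc α) m]

theorem exists_sum_mul_pow_eq_zero
    (hM : ∀ s : M, ∃ a, HasFiniteClass a ∧ HasFiniteClass (s * a))
    (he : Injective e) (hc : ∀ α, e α ∈ Submonoid.center M)
    (halg : ∀ z ∈ Submonoid.center M, ∃ l, 0 < l ∧ ∃ α β, e α * z ^ l = e β)
    (b : MonoidAlgebra F M) (hb : ∀ m ∈ b.coeff.support, HasFiniteClass m) :
    ∃ (n : ℕ) (c : Fin n → MonoidAlgebra F (Multiplicative (σ →₀ ℕ))), (∃ i, c i ≠ 0) ∧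
      ∑ i, mapDomainRingHom F e (c i) * b ^ (i : ℕ) = 0 := by
  classical
  let E := mapDomainRingHom F e
  let inst : Module (MonoidAlgebra F (Multiplicative (σ →₀ ℕ))) (MonoidAlgebra F M) :=
    Module.compHom _ E
  have hsmul (c : MonoidAlgebra F (Multiplicative (σ →₀ ℕ))) (x : MonoidAlgebra F M) :
    c • x = E c * x := rfl
  obtain ⟨T, hbT, hT⟩ := exists_conjStable_superset b.coeff.support hb
  obtain ⟨W, hW⟩ := hT.exists_finset hM hc halg
  let V : Finset (MonoidAlgebra F M) := W.image fun w => single w 1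
  let P := Submodule.span (MonoidAlgebra F (Multiplicative (σ →₀ ℕ))) (V : Set (MonoidAlgebra F M))
  let j := mapDomainRingHom F (Submonoid.closure (T : Set M)).subtype
  have hden (x : MonoidAlgebra F (Submonoid.closure (T : Set M))) :
      ∃ γ, (single γ 1 : MonoidAlgebra F (Multiplicative (σ →₀ ℕ))) • j x ∈ P := by
    induction x using MonoidAlgebra.induction_linear with
    | zero => exact ⟨1, by simp⟩
    | add f g hf hg =>
      obtain ⟨γ, hγ⟩ := hf
      obtain ⟨δ, hδ⟩ := hg
      refine ⟨γ * δ, ?_⟩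
      have h1 : (single (γ * δ) 1 : MonoidAlgebra F (Multiplicative (σ →₀ ℕ))) =
        single γ 1 * single δ 1 := by rw [single_mul_single, one_mul]
      rw [map_add, smul_add, h1]
      refine P.add_mem ?_ ?_
      · rw [mul_comm, mul_smul]
        exact P.smul_mem _ hγ
      · rw [mul_smul]
        exact P.smul_mem _ hδ
    | single m r =>
      obtain ⟨α, β, w, hw, h⟩ := hW m m.2
      refine ⟨α, ?_⟩
      have h1 : (single α 1 : MonoidAlgebra F (Multiplicative (σ →₀ ℕ))) • j (single m r) =
          (single β r : MonoidAlgebra F (Multiplicative (σ →₀ ℕ))) • single w 1 := by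
        simp only [hsmul, E, j, mapDomainRingHom_apply, mapDomain_single, single_mul_single,
          Submonoid.subtype_apply, h, one_mul, mul_one]
      rw [h1]
      exact P.smul_mem _ (Submodule.subset_span (Finset.mem_coe.2 (Finset.mem_image_of_mem _ hw)))
  obtain ⟨b', rfl⟩ : ∃ b', j b' = b := by
    refine ⟨ofCoeff (b.coeff.comapDomain Subtype.val Subtype.val_injective.injOn), ?_⟩
    rw [mapDomainRingHom_apply, ← coeff_inj, coeff_mapDomain]
    exact Finsupp.mapDomain_comapDomain _ Subtype.val_injective _ fun m hm =>
      ⟨⟨m, Submonoid.subset_closure (hbT hm)⟩, rfl⟩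
  choose γ hγ using fun i : ℕ => hden (b' ^ i)
  let δ := ∏ i : Fin (V.card + 1), γ i
  let s : MonoidAlgebra F (Multiplicative (σ →₀ ℕ)) := single δ 1
  have hs : s ≠ 0 := by
    rw [Ne, single_eq_zero]
    exact one_ne_zero
  have hmem (i : Fin (V.card + 1)) : s • j b' ^ (i : ℕ) ∈ P := by
    obtain ⟨η, hη⟩ := Finset.dvd_prod_of_mem (fun i : Fin (V.card + 1) => γ i) (Finset.mem_univ i)
    have h1 : s = single η 1 * single (γ i) 1 := by
      rw [single_mul_single, one_mul, mul_comm η, ← hη]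
    rw [h1, mul_smul, ← map_pow]
    exact P.smul_mem _ (hγ i)
  have hdep : ¬ LinearIndependent (MonoidAlgebra F (Multiplicative (σ →₀ ℕ)))
      fun i : Fin (V.card + 1) => s • j b' ^ (i : ℕ) := by
    intro hli
    have := linearIndependent_le_span_aux' _ hli (V : Set (MonoidAlgebra F M))
      (Set.range_subset_iff.2 hmem)
    simp at this
  obtain ⟨c, hsum, hne⟩ := Fintype.not_linearIndependent_iff.1 hdep
  refine ⟨_, c, hne, ?_⟩
  by_contra h0
  refine mapDomain_mul_ne_zero he hc hs h0 ?_
  rw [← hsum]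
  change s • ∑ i, c i • j b' ^ (i : ℕ) = _
  rw [Finset.smul_sum]
  exact Finset.sum_congr rfl fun i _ => smul_comm _ _ _

theorem exists_mul_eq_mapDomain (hc : ∀ α, e α ∈ Submonoid.center M) {b : MonoidAlgebra F M}
    (hb : ∀ x, b * x = 0 → x = 0) (n : ℕ) (c : Fin n → MonoidAlgebra F (Multiplicative (σ →₀ ℕ)))
    (hne : ∃ i, c i ≠ 0) (h : ∑ i, mapDomainRingHom F e (c i) * b ^ (i : ℕ) = 0) :
    ∃ c ≠ 0, ∃ y, b * y = mapDomainRingHom F e c := by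
  induction n with
  | zero => exact hne.elim fun i => i.elim0
  | succ n ih =>
    have hsum : ∑ i : Fin n, mapDomainRingHom F e (c i.succ) * b ^ (i.succ : ℕ) =
        b * ∑ i : Fin n, mapDomainRingHom F e (c i.succ) * b ^ (i : ℕ) := by
      rw [Finset.mul_sum]
      refine Finset.sum_congr rfl fun i _ => ?_
      rw [Fin.val_succ, pow_succ', ← mul_assoc, (commute_mapDomain hc _ b).eq, mul_assoc]
    rw [Fin.sum_univ_succ, hsum, Fin.val_zero, pow_zero, mul_one] at h
    by_cases h0 : c 0 = 0
    · rw [h0, map_zero, zero_add] at h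
      refine ih (fun i => c i.succ) ?_ (hb _ h)
      obtain ⟨i, hi⟩ := hne
      cases i using Fin.cases with
      | zero => exact absurd h0 hi
      | succ i => exact ⟨i, hi⟩
    · exact ⟨c 0, h0, _, by rw [mul_neg]; exact (eq_neg_of_add_eq_zero_left h).symm⟩

end AlgebraicElements

section SemigroupAlgebra

open MonoidAlgebra

variable {F : Type*} [Field F] {S : Type*} [Semigroup S] [IsCancelMul S]

/-- The support of a central element of a semigroup algebra is conjugation stable. -/
theorem exists_mem_support_of_mem_center {x : MonoidAlgebra F S}
    (hx : x ∈ Set.center (MonoidAlgebra F S)) (t : S) {s : S} (hs : s ∈ x.coeff.support) :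
    ∃ s' ∈ x.coeff.support, t * s = s' * t := by
  have h1 : (single t 1 * x).coeff (t * s) ≠ 0 := by
    rw [coeff_single_mul_eq_mul_coeff s fun m _ => mul_right_inj t, one_mul]
    exact Finsupp.mem_support_iff.1 hs
  rw [Semigroup.mem_center_iff.1 hx] at h1
  by_cases hd : ∃ d, d * t = t * s
  · obtain ⟨d, hd⟩ := hd
    rw [← hd, coeff_mul_single_eq_coeff_mul d fun m _ => mul_left_inj t, mul_one] at h1
    exact ⟨d, Finsupp.mem_support_iff.2 h1, hd.symm⟩
  · push Not at hd
    exact absurd (coeff_mul_single_of_forall_mul_ne _ _ hd) h1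

/-- In a cancellative semigroup with centrally essential semigroup algebra, every element can be
multiplied by an element of a finite conjugation stable set in such a way that the product belongs
to such a set. -/
theorem IsCentrallyEssential.exists_mul_mem_support (h : IsCentrallyEssential (MonoidAlgebra F S))
    (s : S) : ∃ x y : MonoidAlgebra F S, x ∈ Set.center (MonoidAlgebra F S) ∧
      y ∈ Set.center (MonoidAlgebra F S) ∧ ∃ a ∈ x.coeff.support, s * a ∈ y.coeff.support := by
  by_cases hs : single s 1 ∈ Set.center (MonoidAlgebra F S)
  · refine ⟨_, _, hs, Set.mul_mem_center hs hs, s, ?_, ?_⟩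
    · simp
    · simp [single_mul_single]
  · obtain ⟨x, y, hx, hy, hx0, -, rfl⟩ := h _ hs
    obtain ⟨a, ha⟩ : x.coeff.support.Nonempty := by
      simpa [Finsupp.support_nonempty_iff] using hx0
    refine ⟨x, _, hx, hy, a, ha, ?_⟩
    rw [Finsupp.mem_support_iff, coeff_single_mul_eq_mul_coeff a fun m _ => mul_right_inj s,
      one_mul]
    exact Finsupp.mem_support_iff.1 ha

theorem isNonZeroDivisor_single (s : S) : IsNonZeroDivisor (single s 1 : MonoidAlgebra F S) := by
  refine ⟨fun x hx => ?_, fun x hx => ?_⟩ <;> rw [← coeff_eq_zero] <;> ext m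
  · have := coeff_single_mul_eq_mul_coeff (x := x) (r := (1 : F)) m fun _ _ => mul_right_inj s
    rw [hx, one_mul] at this
    exact this.symm
  · have := coeff_mul_single_eq_coeff_mul (x := x) (r := (1 : F)) m fun _ _ => mul_left_inj s
    rw [hx, mul_one] at this
    exact this.symm

variable {M : Type*} [CancelMonoid M] {ι : S →ₙ* M}

theorem hasFiniteClass_of_mem_support_center (hrange : ∀ m, m = 1 ∨ m ∈ Set.range ι)
    {x : MonoidAlgebra F S} (hx : x ∈ Set.center (MonoidAlgebra F S)) {s : S}
    (hs : s ∈ x.coeff.support) : HasFiniteClass (ι s) := by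
  classical
  refine ⟨x.coeff.support.image ι, Finset.mem_image_of_mem _ hs, fun m t ht => ?_⟩
  obtain ⟨t, ht', rfl⟩ := Finset.mem_image.1 ht
  obtain rfl | ⟨r, rfl⟩ := hrange m
  · exact ⟨ι t, ht, by simp⟩
  · obtain ⟨t', h1, h2⟩ := exists_mem_support_of_mem_center hx r ht'
    exact ⟨ι t', Finset.mem_image_of_mem _ h1, by rw [← map_mul, h2, map_mul]⟩

theorem IsCentrallyEssential.exists_hasFiniteClass [Nonempty S]
    (h : IsCentrallyEssential (MonoidAlgebra F S)) (hrange : ∀ m, m = 1 ∨ m ∈ Set.range ι)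
    (m : M) : ∃ a, HasFiniteClass a ∧ HasFiniteClass (m * a) := by
  have hS (s : S) : ∃ a, HasFiniteClass (ι a) ∧ HasFiniteClass (ι (s * a)) := by
    obtain ⟨x, y, hx, hy, a, ha, hsa⟩ := h.exists_mul_mem_support s
    exact ⟨a, hasFiniteClass_of_mem_support_center hrange hx ha,
      hasFiniteClass_of_mem_support_center hrange hy hsa⟩
  obtain rfl | ⟨s, rfl⟩ := hrange m
  · obtain ⟨a, ha, -⟩ := hS (Classical.arbitrary S)
    exact ⟨ι a, ha, by rwa [one_mul]⟩
  · obtain ⟨a, ha, hsa⟩ := hS s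
    exact ⟨ι a, ha, by rwa [← map_mul]⟩

end SemigroupAlgebra

section NonZeroDivisors

open MonoidAlgebra

/-- If every element of `M` becomes of finite class after multiplication by an element of finite
class, then every left non-zero-divisor of the monoid algebra divides a central
non-zero-divisor. -/
theorem exists_mul_mem_centralNonZeroDivisors {F : Type*} [Field F] {M : Type u} [CancelMonoid M]
    (hM : ∀ s : M, ∃ a, HasFiniteClass a ∧ HasFiniteClass (s * a)) {b : MonoidAlgebra F M}
    (hb : ∀ x, b * x = 0 → x = 0) : ∃ y, b * y ∈ centralNonZeroDivisors (MonoidAlgebra F M) := by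
  classical
  obtain ⟨σ, e, he, hc, halg⟩ := exists_free_central M
  obtain ⟨a, -, ha⟩ := exists_forall_mul_hasFiniteClass hM b.coeff.support
  have hsupp : ∀ m ∈ (b * single a 1).coeff.support, HasFiniteClass m := by
    intro m hm
    rw [Finsupp.mem_support_iff] at hm
    by_cases hd : ∃ d, d * a = m
    · obtain ⟨d, rfl⟩ := hd
      rw [coeff_mul_single_eq_coeff_mul d fun _ _ => mul_left_inj a, mul_one] at hm
      exact ha d (Finsupp.mem_support_iff.2 hm)
    · push Not at hd
      exact absurd (coeff_mul_single_of_forall_mul_ne _ _ hd) hm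
  have hreg (x : MonoidAlgebra F M) (hx : b * single a 1 * x = 0) : x = 0 :=
    (isNonZeroDivisor_single a).1 x (hb _ (by rw [← mul_assoc, hx]))
  obtain ⟨n, c, hne, hsum⟩ := exists_sum_mul_pow_eq_zero hM he hc halg _ hsupp
  obtain ⟨c, hc0, y, hy⟩ := exists_mul_eq_mapDomain hc hreg n c hne hsum
  refine ⟨single a 1 * y, ?_⟩
  rw [← mul_assoc, hy]
  have hcomm := commute_mapDomain (F := F) hc c
  have hzero (x : MonoidAlgebra F M) (hx : mapDomainRingHom F e c * x = 0) : x = 0 := by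
    by_contra h
    exact mapDomain_mul_ne_zero he hc hc0 h hx
  exact ⟨Semigroup.mem_center_iff.2 fun x => (hcomm x).symm.eq, hzero,
    fun x hx => hzero x (by rw [(hcomm x).eq, hx])⟩

end NonZeroDivisors

/-- If `S` is a cancellative semigroup and the semigroup algebra `F[S]` is centrally
essential, then `F[S]` has a classical right ring of fractions `Q`, and `Q` is a centrally
essential ring. -/
theorem stmt3 (F : Type u) [Field F] (S : Type u) [Semigroup S] [IsCancelMul S]
    (h : IsCentrallyEssential (MonoidAlgebra F S)) :
    ∃ (Q : Type u) (_ : Ring Q) (φ : MonoidAlgebra F S →ₙ+* Q),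
      IsClassicalRightRingOfFractions (MonoidAlgebra F S) Q φ ∧ IsCentrallyEssential Q := by
  rcases isEmpty_or_nonempty S with hS | hS
  · have hsub : Subsingleton (MonoidAlgebra F S) := MonoidAlgebra.coeff_injective.subsingleton
    refine ⟨PUnit, inferInstance, 0,
      ⟨injective_of_subsingleton _, fun b _ => isUnit_of_subsingleton _,
        fun q => ⟨0, 0, ⟨fun _ _ => Subsingleton.elim _ _, fun _ _ => Subsingleton.elim _ _⟩,
          Subsingleton.elim _ _⟩⟩, fun a ha => absurd ?_ ha⟩
    exact Semigroup.mem_center_iff.2 fun _ => Subsingleton.elim _ _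
  obtain ⟨M, instM, ι, hι, hrange⟩ := exists_cancelMonoid_embedding S
  have hM := fun m => h.exists_hasFiniteClass hrange m
  have hpow (s : S) (n : ℕ) (hn : 0 < n) : ι s ^ n ∈ Set.range ι := by
    induction n, hn using Nat.le_induction with
    | base => exact ⟨s, by simp⟩
    | succ n _ ih =>
      obtain ⟨t, ht⟩ := ih
      exact ⟨t * s, by rw [map_mul, ht, pow_succ]⟩
  obtain ⟨z, hz⟩ : ∃ z, ι z ∈ Submonoid.center M := by
    obtain ⟨a, -, ha⟩ := hM (ι (Classical.arbitrary S))
    have hr : ι (Classical.arbitrary S) * a ∈ Set.range ι := by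
      obtain rfl | ⟨r, rfl⟩ := hrange a
      · exact ⟨_, (mul_one _).symm⟩
      · exact ⟨_, map_mul ι _ _⟩
    obtain ⟨r, hr⟩ := hr
    rw [← hr] at ha
    obtain ⟨n, hn, h⟩ := ha.exists_pow_mem_center hM
    obtain ⟨z, hz⟩ := hpow r n hn
    exact ⟨z, hz ▸ h⟩
  let i := MonoidAlgebra.mapDomainNonUnitalRingHom F ι
  have hisingle (s : S) (r : F) :
      i (MonoidAlgebra.single s r) = MonoidAlgebra.single (ι s) r := MonoidAlgebra.mapDomain_single
  have hiz : i (MonoidAlgebra.single z 1) ∈ centralNonZeroDivisors (MonoidAlgebra F M) := by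
    rw [hisingle]
    refine ⟨Semigroup.mem_center_iff.2 fun x => ?_, isNonZeroDivisor_single _⟩
    induction x using MonoidAlgebra.induction_linear with
    | zero => simp
    | add f g hf hg => rw [add_mul, mul_add, hf, hg]
    | single m r =>
      rw [MonoidAlgebra.single_mul_single, MonoidAlgebra.single_mul_single, mul_comm r,
        Submonoid.mem_center_iff.1 hz m]
  have hAz (r : MonoidAlgebra F M) : ∃ r', i r' = r * i (MonoidAlgebra.single z 1) := by
    induction r using MonoidAlgebra.induction_linear with
    | zero => exact ⟨0, by simp⟩
    | add f g hf hg =>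
      obtain ⟨f', hf⟩ := hf
      obtain ⟨g', hg⟩ := hg
      exact ⟨f' + g', by rw [map_add, hf, hg, add_mul]⟩
    | single m r =>
      obtain rfl | ⟨s, rfl⟩ := hrange m
      · exact ⟨MonoidAlgebra.single z r, by
          rw [hisingle, hisingle, MonoidAlgebra.single_mul_single, one_mul, mul_one]⟩
      · exact ⟨MonoidAlgebra.single (s * z) r, by
          rw [hisingle, hisingle, MonoidAlgebra.single_mul_single, map_mul, mul_one]⟩
  have hi : Injective i := MonoidAlgebra.mapDomain_injective hι
  refine exists_classicalRightRingOfFractions i hi h (fun b hb => ?_) _ hiz hAz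
  refine exists_mul_mem_centralNonZeroDivisors hM fun x hx => hiz.2.2 x ?_
  obtain ⟨x', hx'⟩ := hAz x
  have : b * x' = 0 := hi (by rw [map_mul, hx', ← mul_assoc, hx, zero_mul, map_zero])
  rw [← hx', hb.1 _ this, map_zero]
end

section
/- Let F be a field of characteristic 0 and let S be a cancellative semigroup. If the semigroup algebra FS is a centrally essential ring, then FS is commutative. -/
namespace MonoidAlgebra

variable {S : Type*} [Semigroup S]

open Classical in
/-- A solution `v` of `u * v = d` when there is one, and `u` otherwise. -/
noncomputable def cofactor (d u : S) : S :=
  if h : ∃ v, u * v = d then h.choose else u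

lemma mul_cofactor {d u : S} (h : ∃ v, u * v = d) : u * cofactor d u = d := by
  rw [cofactor, dif_pos h]
  exact h.choose_spec

lemma cofactor_eq [IsLeftCancelMul S] {d u v : S} (h : u * v = d) : cofactor d u = v :=
  mul_left_cancel ((mul_cofactor ⟨v, h⟩).trans h.symm)

/-- The conjugate-linear extension of `cofactor d`; it plays the role of the standard involution
of a complex group algebra. -/
noncomputable def cofactorStar (d : S) : MonoidAlgebra ℂ S →+ MonoidAlgebra ℂ S :=
  (Finsupp.liftAddHom fun u =>
    (singleAddHom (cofactor d u)).comp (starRingEnd ℂ).toAddMonoidHom).comp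
    (coeffAddEquiv (R := ℂ) (M := S)).toAddMonoidHom

lemma cofactorStar_apply (d : S) (x : MonoidAlgebra ℂ S) :
    cofactorStar d x =
      ∑ u ∈ x.coeff.support, single (cofactor d u) (starRingEnd ℂ (x.coeff u)) := rfl

lemma cofactorStar_single (d u : S) (a : ℂ) :
    cofactorStar d (single u a) = single (cofactor d u) (starRingEnd ℂ a) := by
  simp [cofactorStar]

lemma mul_cofactorStar (d : S) (x : MonoidAlgebra ℂ S) :
    x * cofactorStar d x = ∑ u ∈ x.coeff.support, ∑ v ∈ x.coeff.support,
      single (u * cofactor d v) (x.coeff u * starRingEnd ℂ (x.coeff v)) := by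
  conv_lhs =>
    enter [1]
    rw [← sum_coeff_single x, Finsupp.sum]
  rw [Finset.sum_mul]
  refine Finset.sum_congr rfl fun u _ => ?_
  rw [cofactorStar_apply, Finset.mul_sum]
  simp

lemma eq_zero_of_mul_cofactorStar_eq_zero [IsCancelMul S] {d : S} {x : MonoidAlgebra ℂ S}
    (hd : ∀ u ∈ x.coeff.support, ∃ v, u * v = d) (h : x * cofactorStar d x = 0) : x = 0 := by
  classical
  have key : (x * cofactorStar d x).coeff d =
      ((∑ u ∈ x.coeff.support, Complex.normSq (x.coeff u) : ℝ) : ℂ) := by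
    rw [mul_cofactorStar, coeff_sum, Finsupp.finsetSum_apply, Complex.ofReal_sum]
    refine Finset.sum_congr rfl fun u hu => ?_
    rw [coeff_sum, Finsupp.finsetSum_apply, Finset.sum_eq_single u]
    · simp [mul_cofactor (hd u hu), Complex.mul_conj]
    · intro v hv hvu
      rw [coeff_single, Finsupp.single_apply, if_neg]
      intro huv
      exact hvu (mul_right_cancel ((mul_cofactor (hd v hv)).trans huv.symm))
    · exact fun hn => absurd hu hn
  rw [h, coeff_zero, Finsupp.zero_apply] at key
  have key' := (Finset.sum_eq_zero_iff_of_nonneg fun u _ => Complex.normSq_nonneg _).1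
    (Complex.ofReal_eq_zero.1 key.symm)
  ext u
  by_contra hu
  exact hu (Complex.normSq_eq_zero.1 (key' u (Finsupp.mem_support_iff.2 hu)))

section CommonMultiple

variable [IsCancelMul S]

/-- A nonempty finite set normalized by every element of `S` has a common right multiple that
commutes with all of its elements. -/
lemma exists_commute_and_forall_dvd {D : Finset S} (hD : D.Nonempty)
    (hnorm : ∀ s, ∀ t ∈ D, ∃ t' ∈ D, s * t = t' * s) :
    ∃ c : S, (∀ t ∈ D, Commute c t) ∧ ∀ t ∈ D, t ∣ c := by
  classical
  have hpow : ∀ t : S, ∃ p : S, t ∣ p ∧ ∀ s ∈ D, Commute p s := by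
    intro t
    choose! f hfD hf using hnorm t
    let φ : D → D := fun s => ⟨f s, hfD s s.2⟩
    have hφ : Function.Injective φ := by
      intro a b hab
      have : f a = f b := congrArg Subtype.val hab
      refine Subtype.ext (mul_left_cancel (a := t) ?_)
      rw [hf a a.2, hf b b.2, this]
    let e : Equiv.Perm D := Equiv.ofBijective φ (Finite.injective_iff_bijective.1 hφ)
    have hiter : ∀ k : ℕ, ∃ p : S, t ∣ p ∧ ∀ s : D, p * s = (e ^ (k + 2)) s * p := by
      have hstep : ∀ s : D, t * s = e s * t := fun s => hf s s.2
      intro k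
      induction k with
      | zero =>
        refine ⟨t * t, dvd_mul_right t t, fun s => ?_⟩
        rw [mul_assoc, hstep, ← mul_assoc, hstep, mul_assoc]
        rfl
      | succ k ih =>
        obtain ⟨p, -, hp⟩ := ih
        refine ⟨t * p, dvd_mul_right t p, fun s => ?_⟩
        rw [mul_assoc, hp, ← mul_assoc, hstep, mul_assoc, ← Equiv.Perm.mul_apply, ← pow_succ']
    have hpos : 0 < orderOf e := orderOf_pos e
    obtain ⟨p, hdvd, hp⟩ := hiter (2 * orderOf e - 2)
    refine ⟨p, hdvd, fun s hs => ?_⟩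
    have h1 : e ^ (2 * orderOf e - 2 + 2) = 1 := by
      rw [Nat.sub_add_cancel (by omega), mul_comm, pow_mul, pow_orderOf_eq_one, one_pow]
    simpa [h1, commute_iff_eq] using hp ⟨s, hs⟩
  suffices h : ∀ E ⊆ D, ∃ c : S, (∀ t ∈ D, Commute c t) ∧ ∀ t ∈ E, t ∣ c from h D subset_rfl
  intro E
  induction E using Finset.induction with
  | empty =>
    intro _
    obtain ⟨t, -⟩ := hD
    obtain ⟨p, -, hp⟩ := hpow t
    exact ⟨p, hp, by simp⟩
  | insert t E _ ih =>
    intro hE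
    obtain ⟨c, hc, hcE⟩ := ih fun s hs => hE (Finset.mem_insert_of_mem hs)
    obtain ⟨p, hdvd, hp⟩ := hpow t
    refine ⟨p * c, fun s hs => (hp s hs).mul_left (hc s hs), fun s hs => ?_⟩
    rcases Finset.mem_insert.1 hs with rfl | hs'
    · exact hdvd.mul_right c
    · obtain ⟨w, rfl⟩ := hcE s hs'
      rw [← mul_assoc, (hp s (hE hs)).eq, mul_assoc]
      exact dvd_mul_right s _

lemma exists_mem_support_mul_eq {R : Type*} [Semiring R] {z : MonoidAlgebra R S} {s : S}
    (hz : single s 1 * z = z * single s 1) {t : S} (ht : t ∈ z.coeff.support) :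
    ∃ t' ∈ z.coeff.support, s * t = t' * s := by
  by_contra! hne
  have h1 : (single s 1 * z).coeff (s * t) = z.coeff t := by
    simpa using z.coeff_single_mul_eq_mul_coeff (r := 1) (m := s) (m₁ := s * t) t (by simp)
  rw [hz] at h1
  classical
  rw [coeff_mul, Finsupp.sum, Finset.sum_eq_zero] at h1
  · exact Finsupp.mem_support_iff.1 ht h1.symm
  · intro u hu
    simp [(hne u hu).symm]

end CommonMultiple

lemma eq_zero_of_mul_self_eq_zero_complex [IsCancelMul S] {z : MonoidAlgebra ℂ S}
    (hz : ∀ s, single s 1 * z = z * single s 1) (h0 : z * z = 0) : z = 0 := by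
  classical
  by_contra hne
  have hD : z.coeff.support.Nonempty := by
    rwa [Finsupp.support_nonempty_iff, ne_eq, coeff_eq_zero]
  obtain ⟨c, hc, hdvd⟩ :=
    exists_commute_and_forall_dvd hD fun s t ht => exists_mem_support_mul_eq (hz s) ht
  have hr : ∀ t ∈ z.coeff.support, t * cofactor c t = c := fun t ht =>
    mul_cofactor ((hdvd t ht).imp fun _ => Eq.symm)
  have hl : ∀ t ∈ z.coeff.support, cofactor c t * t = c := fun t ht => by
    refine mul_left_cancel (a := t) ?_
    rw [← mul_assoc, hr t ht, (hc t ht).eq]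
  have hmul : ∀ s ∈ z.coeff.support, ∀ t ∈ z.coeff.support,
      s * cofactor c t * (t * cofactor c s) = c * c := by
    intro s hs t ht
    rw [mul_assoc, ← mul_assoc (cofactor c t), hl t ht, ← mul_assoc, ← (hc s hs).eq, mul_assoc,
      hr s hs]
  have hcomm : cofactorStar c z * z = z * cofactorStar c z := by
    rw [cofactorStar_apply, Finset.sum_mul, Finset.mul_sum]
    refine Finset.sum_congr rfl fun u _ => ?_
    have : single (cofactor c u) (starRingEnd ℂ (z.coeff u)) =
        (starRingEnd ℂ (z.coeff u)) • single (cofactor c u) (1 : ℂ) := by simp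
    rw [this, smul_mul_assoc, mul_smul_comm, hz]
  set v := z * cofactorStar c z with hv
  have hvsq : v * v = 0 := by
    rw [hv, mul_assoc, ← mul_assoc _ z, hcomm, mul_assoc, ← mul_assoc, h0, zero_mul]
  have hstar : cofactorStar (c * c) v = v := by
    rw [hv, mul_cofactorStar, map_sum]
    simp_rw [map_sum]
    rw [Finset.sum_comm]
    refine Finset.sum_congr rfl fun t ht => Finset.sum_congr rfl fun s hs => ?_
    rw [cofactorStar_single, cofactor_eq (hmul s hs t ht)]
    simp [mul_comm]
  have hvdvd : ∀ u ∈ v.coeff.support, ∃ w, u * w = c * c := by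
    intro u hu
    by_contra hn
    refine Finsupp.mem_support_iff.1 hu ?_
    rw [hv, mul_cofactorStar]
    simp_rw [coeff_sum, Finsupp.finsetSum_apply]
    refine Finset.sum_eq_zero fun s hs => Finset.sum_eq_zero fun t ht => ?_
    rw [coeff_single, Finsupp.single_apply, if_neg]
    rintro rfl
    exact hn ⟨_, hmul s hs t ht⟩
  have hv0 : v = 0 := eq_zero_of_mul_cofactorStar_eq_zero hvdvd (by rw [hstar, hvsq])
  exact hne (eq_zero_of_mul_cofactorStar_eq_zero (fun t ht => ⟨_, hr t ht⟩) hv0)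

end MonoidAlgebra

lemma exists_ringHom_complex {K : Type*} [Field K] [Algebra ℚ K] [Algebra.FiniteType ℚ K] :
    Nonempty (K →+* ℂ) := by
  have := finite_of_finite_type_of_isJacobsonRing ℚ K
  exact ⟨(IsAlgClosed.lift : K →ₐ[ℚ] ℂ)⟩

lemma exists_ringHom_complex_ne_zero {A : Type*} [CommRing A] [IsReduced A] [Algebra ℚ A]
    [Algebra.FiniteType ℚ A] {a : A} (ha : a ≠ 0) : ∃ f : A →+* ℂ, f a ≠ 0 := by
  have hA : IsJacobsonRing A := isJacobsonRing_of_finiteType (A := ℚ)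
  have hbot : a ∉ (⊥ : Ideal A).jacobson := by
    rwa [hA.out (Ideal.isRadical_iff_quotient_reduced _ |>.2
      (isReduced_of_injective _ (RingEquiv.quotientBot A).injective)), Ideal.mem_bot]
  obtain ⟨m, ⟨-, hm⟩, ham⟩ : ∃ m : Ideal A, (⊥ ≤ m ∧ m.IsMaximal) ∧ a ∉ m := by
    simpa [Ideal.jacobson, Submodule.mem_sInf] using hbot
  let := Ideal.Quotient.field m
  obtain ⟨g⟩ := exists_ringHom_complex (K := A ⧸ m)
  refine ⟨g.comp (Ideal.Quotient.mk m), ?_⟩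
  rwa [RingHom.comp_apply, ne_eq, map_eq_zero_iff g g.injective, Ideal.Quotient.eq_zero_iff_mem]

namespace MonoidAlgebra

lemma eq_zero_of_mul_self_eq_zero_of_commute_single {F : Type*} [Field F] [CharZero F]
    {S : Type*} [Semigroup S] [IsCancelMul S] {z : MonoidAlgebra F S}
    (hz : ∀ s, single s 1 * z = z * single s 1) (h0 : z * z = 0) : z = 0 := by
  classical
  ext t
  by_contra ht
  let A : Subalgebra ℚ F := Algebra.adjoin ℚ (z.coeff.support.image z.coeff : Finset F)
  have : Algebra.FiniteType ℚ A := A.fg_iff_finiteType.1 ⟨_, rfl⟩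
  have hmem : ∀ s, z.coeff s ∈ A := fun s => by
    by_cases hs : z.coeff s = 0
    · rw [hs]
      exact A.zero_mem
    · refine Algebra.subset_adjoin ?_
      simp only [Finset.coe_image, Set.mem_image, Finset.mem_coe, Finsupp.mem_support_iff]
      exact ⟨s, hs, rfl⟩
  let i : A →+* F := A.val
  have hi : Function.Injective (map (M := S) (i : A →+ F)) :=
    map_injective _ Subtype.val_injective
  obtain ⟨y, hy⟩ : z ∈ Set.range (map (M := S) (i : A →+ F)) := by
    rw [range_map]
    exact fun s => ⟨⟨_, hmem s⟩, rfl⟩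
  have hyt : y.coeff t ≠ 0 := by
    intro h
    apply ht
    rw [← hy]
    simp [h]
  obtain ⟨f, hf⟩ := exists_ringHom_complex_ne_zero hyt
  have hy0 : y * y = 0 := hi (by rw [MonoidAlgebra.map_mul, hy, h0, MonoidAlgebra.map_zero])
  have hyc : ∀ s, single s 1 * y = y * single s 1 := fun s => hi (by
    simpa [MonoidAlgebra.map_mul, hy] using hz s)
  have hfy : map (f : A →+ ℂ) y = 0 := by
    refine eq_zero_of_mul_self_eq_zero_complex (fun s => ?_) ?_
    · simpa [MonoidAlgebra.map_mul] using congrArg (map (f : A →+ ℂ)) (hyc s)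
    · rw [← MonoidAlgebra.map_mul, hy0, MonoidAlgebra.map_zero]
  refine hf ?_
  simpa using congrArg (fun x => x.coeff t) hfy

end MonoidAlgebra

lemma IsCentrallyEssential.mul_comm_of_center_reduced {R : Type*} [NonUnitalRing R]
    (h : IsCentrallyEssential R) (hred : ∀ z ∈ Set.center R, z * z = 0 → z = 0) (a b : R) :
    a * b = b * a := by
  have central_comm : ∀ {z}, z ∈ Set.center R → ∀ r, z * r = r * z := fun hz r =>
    (Semigroup.mem_center_iff.1 hz r).symm
  by_contra hab
  set c := a * b - b * a with hc
  have hc0 : c ≠ 0 := sub_ne_zero.2 hab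
  have hkill : ∀ w ∈ Set.center R, a * w ∈ Set.center R → w * c = 0 := by
    intro w hw haw
    have h1 : w * (a * b) = a * w * b := by rw [← mul_assoc, central_comm hw a]
    have h2 : w * (b * a) = a * w * b := by
      rw [central_comm haw b, central_comm hw, mul_assoc]
    rw [hc, mul_sub, h1, h2, sub_self]
  obtain ⟨z, hz, hz0, hzc⟩ : ∃ z ∈ Set.center R, z ≠ 0 ∧ ∀ w, w * c = 0 → w * z = 0 := by
    by_cases hcc : c ∈ Set.center R
    · exact ⟨c, hcc, hc0, fun _ => id⟩
    · obtain ⟨x, y, -, hy, -, hy0, rfl⟩ := h c hcc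
      exact ⟨_, hy, hy0, fun w hw => by rw [← mul_assoc, hw, zero_mul]⟩
  by_cases haz : a * z ∈ Set.center R
  · exact hz0 (hred z hz (hzc z (hkill z hz haz)))
  · obtain ⟨x, y, hx, hy, -, hy0, hxy⟩ := h (a * z) haz
    have hzx : z * x ∈ Set.center R := Set.mul_mem_center hz hx
    rw [mul_assoc] at hxy
    have h1 : z * x * z = 0 := hzc _ (hkill _ hzx (hxy ▸ hy))
    have h2 : z * x = 0 := hred _ hzx (by rw [← mul_assoc, h1, zero_mul])
    exact hy0 (by rw [← hxy, h2, mul_zero])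

/-- If `F` is a field of characteristic `0`, `S` is a cancellative semigroup, and the
semigroup algebra `F[S]` is centrally essential, then `F[S]` is commutative. -/
theorem stmt7 (F : Type*) [Field F] [CharZero F] (S : Type*) [Semigroup S] [IsCancelMul S]
    (h : IsCentrallyEssential (MonoidAlgebra F S)) :
    ∀ a b : MonoidAlgebra F S, a * b = b * a :=
  h.mul_comm_of_center_reduced fun _ hz h0 =>
    MonoidAlgebra.eq_zero_of_mul_self_eq_zero_of_commute_single
      (fun s => Semigroup.mem_center_iff.1 hz (MonoidAlgebra.single s 1)) h0
end
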